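/- Fix an integer n ≥ 0, let Q : ℝ → ℝ be a C² solution of the harmonic map ODE with lim_{r→-∞} Q(r) = 0 and lim_{r→+∞} Q(r) = nπ, and let V, N be as in the reduced wormhole wave equation. Let u : ℝ × ℝ → ℝ be a C² global solution of ∂_t²u − ∂_r²u − (4r/(r²+1)) ∂_r u + V(r) u = N(r, u) such that for every t the quantity ∫_ℝ (|∂_r u(t,r)|² + |∂_t u(t,r)|²)(r²+1)² dr is finite and such that the trajectory of u is totally bounded in the ℋ-norm. Then u is identically zero: u(t,r) = 0 and ∂_t u(t,r) = 0 for all t, r ∈ ℝ. -/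

import Mathlib

open Real Filter MeasureTheory

/-- `F` is a (global, C²) solution of the harmonic map ODE
`F'' + (2r/(r²+1)) F' - sin(2F)/(r²+1) = 0` on the wormhole. -/
def IsHarmonicMapSol (F : ℝ → ℝ) : Prop :=
  ContDiff ℝ 2 F ∧
    ∀ r : ℝ, deriv (deriv F) r + (2 * r / (r ^ 2 + 1)) * deriv F r
      - Real.sin (2 * F r) / (r ^ 2 + 1) = 0

/-- The potential `V(r) = (r²+1)^{-2} + 2(r²+1)^{-1}(cos 2Q - 1)` of the reduced
wormhole wave equation. -/
noncomputable def Vpot (Q : ℝ → ℝ) (r : ℝ) : ℝ :=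
  1 / (r ^ 2 + 1) ^ 2 + 2 / (r ^ 2 + 1) * (Real.cos (2 * Q r) - 1)

/-- The nonlinearity `N(r,u)` of the reduced wormhole wave equation. -/
noncomputable def Npot (Q : ℝ → ℝ) (r v : ℝ) : ℝ :=
  2 * Real.sin (Real.sqrt (r ^ 2 + 1) * v) ^ 2 * Real.sin (2 * Q r)
      / Real.sqrt (r ^ 2 + 1) ^ 3
    + (2 * Real.sqrt (r ^ 2 + 1) * v - Real.sin (2 * Real.sqrt (r ^ 2 + 1) * v)) *
        Real.cos (2 * Q r) / Real.sqrt (r ^ 2 + 1) ^ 3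

/-- `u` is a global C² solution of the reduced wormhole wave equation
`∂_t²u − ∂_r²u − (4r/(r²+1)) ∂_r u + V u = N(r,u)`. -/
def SolvesReduced (Q : ℝ → ℝ) (u : ℝ → ℝ → ℝ) : Prop :=
  ContDiff ℝ 2 (fun p : ℝ × ℝ => u p.1 p.2) ∧
    ∀ t r : ℝ,
      deriv (deriv (fun s => u s r)) t - deriv (deriv (u t)) r
        - (4 * r / (r ^ 2 + 1)) * deriv (u t) r + Vpot Q r * u t r = Npot Q r (u t r)

/-- For every `t`, the solution `u` has finite energy in `ℋ = Ḣ¹ × L²((r²+1)² dr)`. -/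
def FiniteEnergyReduced (u : ℝ → ℝ → ℝ) : Prop :=
  ∀ t : ℝ, Integrable (fun r : ℝ =>
    ((deriv (u t) r) ^ 2 + (deriv (fun s => u s r) t) ^ 2) * (r ^ 2 + 1) ^ 2)

/-- The trajectory `{(u(t), ∂_t u(t)) : t ∈ ℝ}` is totally bounded in the ℋ-norm:
for every `ε > 0` there are finitely many times `t₁, …, t_N` such that every time slice
is within ℋ-distance `ε` of one of them. -/
def TotallyBoundedTraj (u : ℝ → ℝ → ℝ) : Prop :=
  ∀ ε : ℝ, 0 < ε → ∃ (N : ℕ) (ts : Fin N → ℝ), ∀ t : ℝ, ∃ i : Fin N,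
    Real.sqrt (∫ r : ℝ,
      ((deriv (u t) r - deriv (u (ts i)) r) ^ 2 +
        (deriv (fun s => u s r) t - deriv (fun s => u s r) (ts i)) ^ 2) * (r ^ 2 + 1) ^ 2) < ε


/-! ## Two-variable calculus -/

/-- `f` is C¹ on the plane, with partial derivatives `ft`, `fr`. -/
structure C1Plane (f ft fr : ℝ → ℝ → ℝ) : Prop where
  ct : Continuous (fun p : ℝ × ℝ => ft p.1 p.2)
  cr : Continuous (fun p : ℝ × ℝ => fr p.1 p.2)
  d : ∀ t r, HasFDerivAt (fun p : ℝ × ℝ => f p.1 p.2)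
    (ft t r • ContinuousLinearMap.fst ℝ ℝ ℝ + fr t r • ContinuousLinearMap.snd ℝ ℝ ℝ) (t, r)

namespace C1Plane

variable {f ft fr g gt gr : ℝ → ℝ → ℝ}

lemma cf (h : C1Plane f ft fr) : Continuous (fun p : ℝ × ℝ => f p.1 p.2) :=
  continuous_iff_continuousAt.2 fun p => (h.d p.1 p.2).continuousAt

lemma curve (h : C1Plane f ft fr) {a b : ℝ → ℝ} {a' b' s : ℝ} (ha : HasDerivAt a a' s)
    (hb : HasDerivAt b b' s) :
    HasDerivAt (fun s => f (a s) (b s)) (a' * ft (a s) (b s) + b' * fr (a s) (b s)) s := by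
  have h1 := (h.d (a s) (b s)).comp_hasDerivAt s (ha.prodMk hb)
  refine HasDerivAt.congr_deriv h1 ?_
  simp [mul_comm]

lemma dt (h : C1Plane f ft fr) (t r : ℝ) : HasDerivAt (fun s => f s r) (ft t r) t := by
  simpa using h.curve (hasDerivAt_id t) (hasDerivAt_const t r)

lemma dr (h : C1Plane f ft fr) (t r : ℝ) : HasDerivAt (fun s => f t s) (fr t r) r := by
  simpa using h.curve (hasDerivAt_const r t) (hasDerivAt_id r)

lemma of_partial (hct : Continuous (fun p : ℝ × ℝ => ft p.1 p.2))
    (hcr : Continuous (fun p : ℝ × ℝ => fr p.1 p.2))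
    (h1 : ∀ t r, HasDerivAt (fun s => f s r) (ft t r) t)
    (h2 : ∀ t r, HasDerivAt (fun s => f t s) (fr t r) r) : C1Plane f ft fr := by
  refine ⟨hct, hcr, fun t r => ?_⟩
  have := hasStrictFDerivAt_uncurry_coprod (𝕜 := ℝ) (u := (t, r)) (f := f)
    (f₁ := fun t r => ContinuousLinearMap.toSpanSingleton ℝ (ft t r))
    (f₂ := fun t r => ContinuousLinearMap.toSpanSingleton ℝ (fr t r))
    (Eventually.of_forall fun v => (h1 v.1 v.2).hasFDerivAt)
    (Eventually.of_forall fun v => (h2 v.1 v.2).hasFDerivAt)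
    (by
      have : Continuous (fun p : ℝ × ℝ => ContinuousLinearMap.toSpanSingleton ℝ (ft p.1 p.2)) := by
        have := (ContinuousLinearMap.toSpanSingletonCLE (𝕜 := ℝ) (E := ℝ)).continuous.comp hct
        exact this
      exact this.continuousAt)
    (by
      have : Continuous (fun p : ℝ × ℝ => ContinuousLinearMap.toSpanSingleton ℝ (fr p.1 p.2)) := by
        have := (ContinuousLinearMap.toSpanSingletonCLE (𝕜 := ℝ) (E := ℝ)).continuous.comp hcr
        exact this
      exact this.continuousAt)
  have h3 := this.hasFDerivAt
  refine HasFDerivAt.congr_fderiv (f := fun p : ℝ × ℝ => f p.1 p.2) h3 ?_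
  ext <;> simp [Function.HasUncurry.uncurry]

lemma add (hf : C1Plane f ft fr) (hg : C1Plane g gt gr) :
    C1Plane (fun t r => f t r + g t r) (fun t r => ft t r + gt t r) (fun t r => fr t r + gr t r) :=
  of_partial (hf.ct.add hg.ct) (hf.cr.add hg.cr) (fun t r => (hf.dt t r).add (hg.dt t r))
    (fun t r => (hf.dr t r).add (hg.dr t r))

lemma sub (hf : C1Plane f ft fr) (hg : C1Plane g gt gr) :
    C1Plane (fun t r => f t r - g t r) (fun t r => ft t r - gt t r) (fun t r => fr t r - gr t r) :=
  of_partial (hf.ct.sub hg.ct) (hf.cr.sub hg.cr) (fun t r => (hf.dt t r).sub (hg.dt t r))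
    (fun t r => (hf.dr t r).sub (hg.dr t r))

lemma neg (hf : C1Plane f ft fr) :
    C1Plane (fun t r => - f t r) (fun t r => - ft t r) (fun t r => - fr t r) :=
  of_partial hf.ct.neg hf.cr.neg (fun t r => (hf.dt t r).neg)
    (fun t r => (hf.dr t r).neg)

lemma smul (hf : C1Plane f ft fr) {a a' : ℝ → ℝ} (ha : ∀ r, HasDerivAt a (a' r) r)
    (ca' : Continuous a') :
    C1Plane (fun t r => a r * f t r) (fun t r => a r * ft t r)
      (fun t r => a' r * f t r + a r * fr t r) := by
  have ca : Continuous a := continuous_iff_continuousAt.2 fun r => (ha r).continuousAt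
  have := hf.cf
  have := hf.cr
  have := hf.ct
  exact of_partial (by fun_prop) (by fun_prop) (fun t r => (hf.dt t r).const_mul _)
    (fun t r => (ha r).mul (hf.dr t r))

lemma shift (hf : C1Plane f ft fr) (τ : ℝ) :
    C1Plane (fun t r => f (t + τ) r) (fun t r => ft (t + τ) r) (fun t r => fr (t + τ) r) := by
  have := hf.cr
  have := hf.ct
  refine of_partial ?_ ?_ (fun t r => ?_) (fun t r => hf.dr (t + τ) r)
  · exact hf.ct.comp (by fun_prop : Continuous fun p : ℝ × ℝ => (p.1 + τ, p.2))
  · exact hf.cr.comp (by fun_prop : Continuous fun p : ℝ × ℝ => (p.1 + τ, p.2))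
  · simpa using hf.curve ((hasDerivAt_id t).add_const τ) (hasDerivAt_const t r)

lemma rev (hf : C1Plane f ft fr) :
    C1Plane (fun t r => f (-t) r) (fun t r => -ft (-t) r) (fun t r => fr (-t) r) := by
  refine of_partial ?_ ?_ (fun t r => ?_) (fun t r => hf.dr (-t) r)
  · exact (hf.ct.comp (by fun_prop : Continuous fun p : ℝ × ℝ => (-p.1, p.2))).neg
  · exact hf.cr.comp (by fun_prop : Continuous fun p : ℝ × ℝ => (-p.1, p.2))
  · simpa using hf.curve ((hasDerivAt_id t).neg) (hasDerivAt_const t r)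

lemma refl (hf : C1Plane f ft fr) :
    C1Plane (fun t r => f t (-r)) (fun t r => ft t (-r)) (fun t r => -fr t (-r)) := by
  refine of_partial ?_ ?_ (fun t r => hf.dt t (-r)) (fun t r => ?_)
  · exact (hf.ct.comp (by fun_prop : Continuous fun p : ℝ × ℝ => (p.1, -p.2)))
  · exact (hf.cr.comp (by fun_prop : Continuous fun p : ℝ × ℝ => (p.1, -p.2))).neg
  · simpa using hf.curve (hasDerivAt_const r t) ((hasDerivAt_id r).neg)

/-- differentiation under the integral sign on a compact interval -/
lemma hasDerivAt_param {f ft : ℝ → ℝ → ℝ} (cf : Continuous (fun p : ℝ × ℝ => f p.1 p.2))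
    (ct : Continuous (fun p : ℝ × ℝ => ft p.1 p.2))
    (h : ∀ t r, HasDerivAt (fun s => f s r) (ft t r) t) (a b t : ℝ) :
    HasDerivAt (fun t => ∫ ρ in a..b, f t ρ) (∫ ρ in a..b, ft t ρ) t := by
  have hK : IsCompact (Metric.closedBall t 1 ×ˢ Set.uIcc a b) :=
    (isCompact_closedBall t 1).prod isCompact_uIcc
  obtain ⟨C, hC⟩ := hK.exists_bound_of_continuousOn ct.continuousOn
  refine (intervalIntegral.hasDerivAt_integral_of_dominated_loc_of_deriv_le
    (bound := fun _ => C) (Metric.closedBall_mem_nhds t one_pos) ?_ ?_ ?_ ?_ ?_ ?_).2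
  · exact Eventually.of_forall fun x =>
      (cf.comp (Continuous.prodMk_right x)).aestronglyMeasurable
  · exact (cf.comp (Continuous.prodMk_right t)).intervalIntegrable _ _
  · exact (ct.comp (Continuous.prodMk_right t)).aestronglyMeasurable
  · exact Eventually.of_forall fun r hr x hx => hC (x, r) ⟨hx, Set.uIoc_subset_uIcc hr⟩
  · exact intervalIntegrable_const
  · exact Eventually.of_forall fun r hr x hx => h x r

lemma integral (cf : Continuous (fun p : ℝ × ℝ => f p.1 p.2))
    (ct : Continuous (fun p : ℝ × ℝ => ft p.1 p.2))
    (hd : ∀ t r, HasDerivAt (fun s => f s r) (ft t r) t) (R : ℝ) :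
    C1Plane (fun t r => ∫ ρ in r..R, f t ρ) (fun t r => ∫ ρ in r..R, ft t ρ)
      (fun t r => - f t r) := by
  refine of_partial ?_ cf.neg (fun t r => hasDerivAt_param cf ct hd r R t)
    (fun t r => ?_)
  · have : Continuous (fun p : ℝ × ℝ => - ∫ ρ in R..p.2, ft p.1 ρ) := by
      refine (intervalIntegral.continuous_parametric_intervalIntegral_of_continuous
        (f := fun (p : ℝ × ℝ) ρ => ft p.1 ρ) ?_ continuous_snd).neg
      exact ct.comp (by fun_prop : Continuous fun p : (ℝ × ℝ) × ℝ => (p.1.1, p.2))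
    refine this.congr fun p => ?_
    exact (intervalIntegral.integral_symm _ _).symm
  · have c : Continuous (f t) := cf.comp (Continuous.prodMk_right t)
    exact intervalIntegral.integral_hasDerivAt_left (c.intervalIntegrable _ _)
      c.aestronglyMeasurable.stronglyMeasurableAtFilter c.continuousAt

end C1Plane

/-- a C² function on the plane with all its partial derivatives -/
structure C2Plane (w wt wr wtt wtr wrr : ℝ → ℝ → ℝ) : Prop where
  c0 : C1Plane w wt wr
  c1 : C1Plane wt wtt wtr
  c2 : C1Plane wr wtr wrr

lemma exists_C2Plane {u : ℝ → ℝ → ℝ} (hu : ContDiff ℝ 2 (fun p : ℝ × ℝ => u p.1 p.2)) :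
    ∃ ut ur utt utr urr, C2Plane u ut ur utt utr urr := by
  set f : ℝ × ℝ → ℝ := fun p => u p.1 p.2 with hf
  have h1 : ContDiff ℝ 1 (fderiv ℝ f) := hu.fderiv_right (by norm_num)
  have hd : ∀ p, HasFDerivAt f (fderiv ℝ f p) p := fun p =>
    (hu.differentiable (by norm_num) p).hasFDerivAt
  have hd1 : ∀ p, HasFDerivAt (fderiv ℝ f) (fderiv ℝ (fderiv ℝ f) p) p := fun p =>
    (h1.differentiable (by norm_num) p).hasFDerivAt
  have c1 : Continuous (fderiv ℝ f) := h1.continuous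
  have c2 : Continuous (fderiv ℝ (fderiv ℝ f)) := h1.continuous_fderiv (by norm_num)
  have sym : ∀ p v w, fderiv ℝ (fderiv ℝ f) p v w = fderiv ℝ (fderiv ℝ f) p w v := fun p v w =>
    (hu.contDiffAt (x := p)).isSymmSndFDerivAt (by simp) v w
  have lin : ∀ (L : ℝ × ℝ →L[ℝ] ℝ), L = L (1, 0) • ContinuousLinearMap.fst ℝ ℝ ℝ
      + L (0, 1) • ContinuousLinearMap.snd ℝ ℝ ℝ := by
    intro L; ext <;> simp
  have key : ∀ v : ℝ × ℝ, C1Plane (fun t r => fderiv ℝ f (t, r) v)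
      (fun t r => fderiv ℝ (fderiv ℝ f) (t, r) (1, 0) v)
      (fun t r => fderiv ℝ (fderiv ℝ f) (t, r) (0, 1) v) := by
    intro v
    refine ⟨by fun_prop, by fun_prop, fun t r => ?_⟩
    have h3 := (hd1 (t, r)).clm_apply (hasFDerivAt_const v (t, r))
    refine h3.congr_fderiv ?_
    ext <;> simp
  refine ⟨fun t r => fderiv ℝ f (t, r) (1, 0), fun t r => fderiv ℝ f (t, r) (0, 1), _, _,
    fun t r => fderiv ℝ (fderiv ℝ f) (t, r) (0, 1) (0, 1), ⟨by fun_prop, by fun_prop, fun t r => ?_⟩, key _, ?_⟩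
  · exact (hd (t, r)).congr_fderiv (lin _)
  · have := key (0, 1)
    simp only [sym _ (1, 0) (0, 1)] at this
    exact this


section

/-! ## Elementary helpers -/

lemma abs_sub_le_of_deriv {X X' B B' : ℝ → ℝ} {a b : ℝ} (hab : a ≤ b)
    (hX : ∀ s ∈ Set.Icc a b, HasDerivAt X (X' s) s)
    (hB : ∀ s ∈ Set.Icc a b, HasDerivAt B (B' s) s)
    (h : ∀ s ∈ Set.Icc a b, |X' s| ≤ B' s) : |X b - X a| ≤ B b - B a := by
  have h1 : MonotoneOn (fun s => B s - X s) (Set.Icc a b) := by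
    refine monotoneOn_of_hasDerivWithinAt_nonneg (convex_Icc a b)
      (fun s hs => ((hB s hs).sub (hX s hs)).continuousAt.continuousWithinAt)
      (fun s hs => ((hB s (interior_subset hs)).sub (hX s (interior_subset hs))).hasDerivWithinAt)
      (fun s hs => ?_)
    have := abs_le.1 (h s (interior_subset hs)); linarith
  have h2 : MonotoneOn (fun s => B s + X s) (Set.Icc a b) := by
    refine monotoneOn_of_hasDerivWithinAt_nonneg (convex_Icc a b)
      (fun s hs => ((hB s hs).add (hX s hs)).continuousAt.continuousWithinAt)
      (fun s hs => ((hB s (interior_subset hs)).add (hX s (interior_subset hs))).hasDerivWithinAt)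
      (fun s hs => ?_)
    have := abs_le.1 (h s (interior_subset hs)); linarith
  have h3 := h1 (Set.left_mem_Icc.2 hab) (Set.right_mem_Icc.2 hab) hab
  have h4 := h2 (Set.left_mem_Icc.2 hab) (Set.right_mem_Icc.2 hab) hab
  simp only at h3 h4
  rw [abs_le]; constructor <;> linarith

lemma hasDerivAt_inv_pow (k : ℕ) (c : ℝ) {s : ℝ} (hs : 0 < c + s) :
    HasDerivAt (fun s => -(1 / ((k + 1 : ℝ) * (c + s) ^ (k + 1)))) (1 / (c + s) ^ (k + 2)) s := by
  have h1 : HasDerivAt (fun s => (c + s) ^ (k + 1)) ((k + 1 : ℝ) * (c + s) ^ k) s := by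
    have h0 := ((hasDerivAt_id s).const_add c).fun_pow (k + 1)
    refine h0.congr_deriv ?_
    simp
  have h2 := ((h1.const_mul (k + 1 : ℝ)).inv (by positivity)).neg
  simp only [one_div]
  refine h2.congr_deriv ?_
  field_simp
  ring

lemma integral_inv_pow_le (k : ℕ) {a b : ℝ} (ha : 0 < a) (hab : a ≤ b) :
    ∫ ρ in a..b, 1 / ρ ^ (k + 2) ≤ 1 / a ^ (k + 1) := by
  have hd : ∀ s ∈ Set.uIcc a b,
      HasDerivAt (fun s => -(1 / ((k + 1 : ℝ) * s ^ (k + 1)))) (1 / s ^ (k + 2)) s := by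
    intro s hs
    rw [Set.uIcc_of_le hab] at hs
    have h0 : (0 : ℝ) < 0 + s := by linarith [hs.1]
    simpa using hasDerivAt_inv_pow k 0 h0
  have hi : IntervalIntegrable (fun s : ℝ => 1 / s ^ (k + 2)) volume a b := by
    refine ContinuousOn.intervalIntegrable ?_
    rw [Set.uIcc_of_le hab]
    refine continuousOn_const.div (by fun_prop) ?_
    intro s hs
    have : 0 < s := by linarith [hs.1]
    positivity
  rw [intervalIntegral.integral_eq_sub_of_hasDerivAt hd hi]
  have hb : 0 < b := by linarith
  have h1 : 0 ≤ 1 / ((k + 1 : ℝ) * b ^ (k + 1)) := by positivity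
  have h2 : 1 / ((k + 1 : ℝ) * a ^ (k + 1)) ≤ 1 / a ^ (k + 1) := by
    apply one_div_le_one_div_of_le (by positivity)
    have : 0 ≤ (k : ℝ) * a ^ (k + 1) := by positivity
    linarith
  linarith

/-- the continuous cut-off version of `1/ρ` -/
noncomputable def kap (ρ : ℝ) : ℝ := (max ρ 1)⁻¹

lemma kap_cont : Continuous kap := by
  unfold kap
  refine Continuous.inv₀ (by fun_prop) fun x => ?_
  have : 1 ≤ max x 1 := le_max_right _ _
  linarith

lemma kap_eq {ρ : ℝ} (h : 1 ≤ ρ) : kap ρ = 1 / ρ := by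
  unfold kap; rw [max_eq_left h, one_div]

variable {w wt wr wtt wtr wrr : ℝ → ℝ → ℝ}

/-- `∫ w_tt / ρ` through the conjugated quantity. -/
lemma flux_identity (hw : C2Plane w wt wr wtt wtr wrr) {t r R : ℝ} (hr : 1 ≤ r) (hR : r ≤ R) :
    ∫ ρ in r..R, kap ρ * wtt t ρ =
      (∫ ρ in r..R, (wtt t ρ - wrr t ρ + 2 * w t ρ / ρ ^ 2) / ρ)
      + ((wr t R + w t R / R) / R - (wr t r + w t r / r) / r) := by
  have c0 : Continuous (w t) := hw.c0.cf.comp (Continuous.prodMk_right t)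
  have c1 : Continuous (wtt t) := hw.c1.ct.comp (Continuous.prodMk_right t)
  have c2 : Continuous (wrr t) := hw.c2.cr.comp (Continuous.prodMk_right t)
  have hne : ∀ s ∈ Set.uIcc r R, s ≠ 0 := by
    intro s hs; rw [Set.uIcc_of_le hR] at hs; linarith [hs.1]
  have hd : ∀ s ∈ Set.uIcc r R, HasDerivAt (fun s => (wr t s + w t s / s) / s)
      ((wrr t s - 2 * w t s / s ^ 2) / s) s := by
    intro s hs
    have h0 := hne s hs
    have := ((hw.c2.dr t s).add ((hw.c0.dr t s).div (hasDerivAt_id s) h0)).div (hasDerivAt_id s) h0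
    refine this.congr_deriv ?_
    simp only [id, Pi.add_apply, Pi.div_apply]
    field_simp
    ring
  have hi : IntervalIntegrable (fun s => (wrr t s - 2 * w t s / s ^ 2) / s) volume r R := by
    apply ContinuousOn.intervalIntegrable
    have h2 : ∀ s ∈ Set.uIcc r R, s ^ 2 ≠ 0 := fun s hs => pow_ne_zero _ (hne s hs)
    fun_prop (disch := assumption)
  have hi2 : IntervalIntegrable (fun ρ => (wtt t ρ - wrr t ρ + 2 * w t ρ / ρ ^ 2) / ρ)
      volume r R := by
    apply ContinuousOn.intervalIntegrable
    have h2 : ∀ s ∈ Set.uIcc r R, s ^ 2 ≠ 0 := fun s hs => pow_ne_zero _ (hne s hs)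
    fun_prop (disch := assumption)
  rw [← intervalIntegral.integral_eq_sub_of_hasDerivAt hd hi,
    ← intervalIntegral.integral_add hi2 hi]
  refine intervalIntegral.integral_congr fun s hs => ?_
  have h0 := hne s hs
  have : 1 ≤ s := by rw [Set.uIcc_of_le hR] at hs; linarith [hs.1]
  rw [kap_eq this]
  field_simp
  ring

lemma abs_integral_F_le {F : ℝ → ℝ} {C R0 : ℝ} (k : ℕ)
    (hF : ∀ r, R0 ≤ r → |F r| ≤ C / r ^ (k + 2)) (hR0 : 1 ≤ R0) {r R : ℝ} (hr : R0 ≤ r)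
    (hR : r ≤ R) : |∫ ρ in r..R, F ρ / ρ| ≤ C / r ^ (k + 2) := by
  have hC : 0 ≤ C := by
    have h1 := (abs_nonneg _).trans (hF r hr)
    have h2 : 0 < r ^ (k + 2) := by have : 0 < r := by linarith
                                    positivity
    by_contra h
    have := div_neg_of_neg_of_pos (not_le.1 h) h2
    linarith
  have hr0 : 0 < r := by linarith
  have h1 : |∫ ρ in r..R, F ρ / ρ| ≤ ∫ ρ in r..R, C * (1 / ρ ^ (k + 1 + 2)) := by
    rw [← Real.norm_eq_abs]
    refine intervalIntegral.norm_integral_le_of_norm_le hR ?_ ?_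
    · refine Eventually.of_forall fun s hs => ?_
      have hs0 : 0 < s := by linarith [hs.1]
      rw [Real.norm_eq_abs, abs_div, abs_of_pos hs0, div_le_iff₀ hs0]
      refine (hF s (by linarith [hs.1])).trans (le_of_eq ?_)
      field_simp
      ring
    · refine ContinuousOn.intervalIntegrable ?_
      rw [Set.uIcc_of_le hR]
      refine continuousOn_const.mul (continuousOn_const.div (by fun_prop) ?_)
      intro s hs
      have : 0 < s := by linarith [hs.1]
      positivity
  rw [intervalIntegral.integral_const_mul] at h1
  refine h1.trans ?_
  have := mul_le_mul_of_nonneg_left (integral_inv_pow_le (k + 1) hr0 hR) hC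
  rw [mul_one_div] at this
  exact this

/-- characteristic estimate for the outgoing null direction -/
lemma char_estimate (hw : C2Plane w wt wr wtt wtr wrr) {C R0 : ℝ} (k : ℕ) (hR0 : 1 ≤ R0)
    (hF : ∀ t r, R0 ≤ r → |wtt t r - wrr t r + 2 * w t r / r ^ 2| ≤ C / r ^ (k + 2))
    {t0 r0 T R : ℝ} (hr : R0 ≤ r0) (hT : 0 ≤ T) (hR : r0 + T ≤ R) :
    |wt t0 r0 - wr t0 r0 - w t0 r0 / r0 - ∫ ρ in r0..R, kap ρ * wt t0 ρ| ≤
      |wt (t0 + T) (r0 + T) - wr (t0 + T) (r0 + T) - w (t0 + T) (r0 + T) / (r0 + T)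
        - ∫ ρ in (r0 + T)..R, kap ρ * wt (t0 + T) ρ|
      + 2 * C / r0 ^ (k + 1)
      + ∫ σ in (0 : ℝ)..T, |wr (t0 + σ) R + w (t0 + σ) R / R| / R := by
  have ckw : Continuous (fun p : ℝ × ℝ => kap p.2 * wt p.1 p.2) :=
    (kap_cont.comp continuous_snd).mul hw.c0.ct
  have ckw' : Continuous (fun p : ℝ × ℝ => kap p.2 * wtt p.1 p.2) :=
    (kap_cont.comp continuous_snd).mul hw.c1.ct
  have hm : C1Plane (fun t r => ∫ ρ in r..R, kap ρ * wt t ρ)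
      (fun t r => ∫ ρ in r..R, kap ρ * wtt t ρ) (fun t r => -(kap r * wt t r)) :=
    C1Plane.integral ckw ckw' (fun t r => (hw.c1.dt t r).const_mul _) R
  have la : ∀ s, HasDerivAt (fun s => t0 + s) 1 s := fun s => (hasDerivAt_id s).const_add t0
  have lb : ∀ s, HasDerivAt (fun s => r0 + s) 1 s := fun s => (hasDerivAt_id s).const_add r0
  have hC : 0 ≤ C := by
    have h1 := (abs_nonneg _).trans (hF t0 r0 hr)
    have h2 : 0 < r0 ^ (k + 2) := by have : 0 < r0 := by linarith
                                     positivity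
    by_contra h
    have := div_neg_of_neg_of_pos (not_le.1 h) h2
    linarith
  have cR : Continuous (fun σ => |wr (t0 + σ) R + w (t0 + σ) R / R| / R) := by
    have h1 : Continuous (fun σ => wr (t0 + σ) R) :=
      hw.c2.cf.comp (by fun_prop : Continuous fun σ : ℝ => (t0 + σ, R))
    have h2 : Continuous (fun σ => w (t0 + σ) R) :=
      hw.c0.cf.comp (by fun_prop : Continuous fun σ : ℝ => (t0 + σ, R))
    exact ((h1.add (h2.div_const R)).abs).div_const R
  have main := abs_sub_le_of_deriv (a := 0) (b := T) hT
    (X := fun s => wt (t0 + s) (r0 + s) - wr (t0 + s) (r0 + s) - w (t0 + s) (r0 + s) / (r0 + s)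
        - ∫ ρ in (r0 + s)..R, kap ρ * wt (t0 + s) ρ)
    (X' := fun s => (wtt (t0 + s) (r0 + s) - wrr (t0 + s) (r0 + s)
        + 2 * w (t0 + s) (r0 + s) / (r0 + s) ^ 2)
        - (∫ ρ in (r0 + s)..R, (wtt (t0 + s) ρ - wrr (t0 + s) ρ + 2 * w (t0 + s) ρ / ρ ^ 2) / ρ)
        - (wr (t0 + s) R + w (t0 + s) R / R) / R)
    (B := fun s => 2 * C * (-(1 / ((k + 1 : ℝ) * (r0 + s) ^ (k + 1))))
        + ∫ σ in (0 : ℝ)..s, |wr (t0 + σ) R + w (t0 + σ) R / R| / R)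
    (B' := fun s => 2 * C * (1 / (r0 + s) ^ (k + 2)) + |wr (t0 + s) R + w (t0 + s) R / R| / R)
    ?_ ?_ ?_
  · simp only [add_zero, intervalIntegral.integral_same] at main
    have hT0 : 0 < r0 + T := by linarith
    have hr00 : 0 < r0 := by linarith
    have e1 : 0 ≤ 2 * C * (1 / ((k + 1 : ℝ) * (r0 + T) ^ (k + 1))) := by positivity
    have e2 : 2 * C * (1 / ((k + 1 : ℝ) * r0 ^ (k + 1))) ≤ 2 * C / r0 ^ (k + 1) := by
      rw [← mul_one_div (2 * C) (r0 ^ (k + 1))]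
      refine mul_le_mul_of_nonneg_left ?_ (by positivity)
      apply one_div_le_one_div_of_le (by positivity)
      have : 0 ≤ (k : ℝ) * r0 ^ (k + 1) := by positivity
      linarith
    have tri := abs_sub_abs_le_abs_sub
      (wt t0 r0 - wr t0 r0 - w t0 r0 / r0 - ∫ ρ in r0..R, kap ρ * wt t0 ρ)
      (wt (t0 + T) (r0 + T) - wr (t0 + T) (r0 + T) - w (t0 + T) (r0 + T) / (r0 + T)
        - ∫ ρ in (r0 + T)..R, kap ρ * wt (t0 + T) ρ)
    rw [abs_sub_comm] at main
    linarith
  · intro s hs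
    have hs0 : r0 + s ≠ 0 := by linarith [hs.1]
    have hs1 : 1 ≤ r0 + s := by linarith [hs.1]
    have h := (((hw.c1.curve (la s) (lb s)).sub (hw.c2.curve (la s) (lb s))).sub
      ((hw.c0.curve (la s) (lb s)).div (lb s) hs0)).sub (hm.curve (la s) (lb s))
    refine h.congr_deriv ?_
    rw [flux_identity hw hs1 (by linarith [hs.2]), kap_eq hs1]
    field_simp
    ring
  · intro s hs
    have hs1 : 0 < r0 + s := by linarith [hs.1]
    exact ((hasDerivAt_inv_pow k r0 hs1).const_mul (2 * C)).add
      (cR.integral_hasStrictDerivAt 0 s).hasDerivAt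
  · intro s hs
    have hs1 : R0 ≤ r0 + s := by linarith [hs.1]
    have hRp : 0 < R := by linarith
    have e1 := hF (t0 + s) (r0 + s) hs1
    have e2 := abs_integral_F_le k (F := fun ρ => wtt (t0 + s) ρ - wrr (t0 + s) ρ
      + 2 * w (t0 + s) ρ / ρ ^ 2) (fun r hr => hF (t0 + s) r hr) hR0 hs1
      (by linarith [hs.2] : r0 + s ≤ R)
    have e3 : |(wr (t0 + s) R + w (t0 + s) R / R) / R|
        = |wr (t0 + s) R + w (t0 + s) R / R| / R := by
      rw [abs_div, abs_of_pos hRp]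
    have t1 := abs_sub (wtt (t0 + s) (r0 + s) - wrr (t0 + s) (r0 + s)
        + 2 * w (t0 + s) (r0 + s) / (r0 + s) ^ 2
        - ∫ ρ in (r0 + s)..R, (wtt (t0 + s) ρ - wrr (t0 + s) ρ + 2 * w (t0 + s) ρ / ρ ^ 2) / ρ)
        ((wr (t0 + s) R + w (t0 + s) R / R) / R)
    have t2 := abs_sub (wtt (t0 + s) (r0 + s) - wrr (t0 + s) (r0 + s)
        + 2 * w (t0 + s) (r0 + s) / (r0 + s) ^ 2)
        (∫ ρ in (r0 + s)..R, (wtt (t0 + s) ρ - wrr (t0 + s) ρ + 2 * w (t0 + s) ρ / ρ ^ 2) / ρ)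
    have e4 : 2 * C * (1 / (r0 + s) ^ (k + 2)) = C / (r0 + s) ^ (k + 2) + C / (r0 + s) ^ (k + 2) := by
      ring
    rw [e4]
    linarith

end


section

variable {w wt wr wtt wtr wrr : ℝ → ℝ → ℝ}

/-- energy density of the exterior problem -/
noncomputable def edens (w wt wr : ℝ → ℝ → ℝ) (t r : ℝ) : ℝ :=
  wt t r ^ 2 + (wr t r - 2 * r / (r ^ 2 + 1) * w t r) ^ 2

/-- uniform exterior bounds -/
structure ExtBound (A E : ℝ) (w wt wr : ℝ → ℝ → ℝ) : Prop where
  hA : ∀ t r, 1 ≤ r → |w t r| ≤ A * √r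
  hE : ∀ t a b, 1 ≤ a → a ≤ b → ∫ r in a..b, edens w wt wr t r ≤ E
  tail : ∀ ε, 0 < ε → ∃ ρ, 1 ≤ ρ ∧ ∀ t a b, ρ ≤ a → a ≤ b → ∫ r in a..b, edens w wt wr t r ≤ ε

lemma edens_cont (hw : C2Plane w wt wr wtt wtr wrr) :
    Continuous (fun p : ℝ × ℝ => edens w wt wr p.1 p.2) := by
  unfold edens
  have h1 := hw.c0.ct
  have h2 := hw.c0.cr
  have h3 := hw.c0.cf
  have h4 : Continuous (fun p : ℝ × ℝ => 2 * p.2 / (p.2 ^ 2 + 1)) :=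
    Continuous.div (by fun_prop) (by fun_prop) (fun p => by positivity)
  exact (h1.pow 2).add ((h2.sub (h4.mul h3)).pow 2)

lemma edens_nonneg (t r : ℝ) : 0 ≤ edens w wt wr t r := by unfold edens; positivity

lemma ExtBound.A_nonneg {A E : ℝ} (hx : ExtBound A E w wt wr) : 0 ≤ A := by
  have := (abs_nonneg _).trans (hx.hA 0 1 le_rfl); simpa using this

lemma ExtBound.E_nonneg {A E : ℝ} (hx : ExtBound A E w wt wr) : 0 ≤ E := by
  have := hx.hE 0 1 1 le_rfl le_rfl; simpa using this

lemma ExtBound.rev {A E : ℝ} (hx : ExtBound A E w wt wr) :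
    ExtBound A E (fun t r => w (-t) r) (fun t r => - wt (-t) r) (fun t r => wr (-t) r) := by
  have he : ∀ t r, edens (fun t r => w (-t) r) (fun t r => - wt (-t) r) (fun t r => wr (-t) r) t r
      = edens w wt wr (-t) r := by intro t r; simp [edens]
  refine ⟨fun t r hr => hx.hA (-t) r hr, fun t a b ha hab => ?_, fun ε hε => ?_⟩
  · simp only [he]; exact hx.hE (-t) a b ha hab
  · obtain ⟨ρ, h1, h2⟩ := hx.tail ε hε
    refine ⟨ρ, h1, fun t a b ha hab => ?_⟩
    simp only [he]; exact h2 (-t) a b ha hab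

lemma C2Plane.rev (hw : C2Plane w wt wr wtt wtr wrr) :
    C2Plane (fun t r => w (-t) r) (fun t r => - wt (-t) r) (fun t r => wr (-t) r)
      (fun t r => wtt (-t) r) (fun t r => - wtr (-t) r) (fun t r => wrr (-t) r) := by
  refine ⟨hw.c0.rev, ?_, hw.c2.rev⟩
  simpa using hw.c1.rev.neg

lemma ExtBound.H_le {A E : ℝ} (hx : ExtBound A E w wt wr) (t : ℝ) {r : ℝ} (hr : 1 ≤ r) :
    |wr t r + w t r / r| ≤ |wr t r - 2 * r / (r ^ 2 + 1) * w t r| + 3 * A / √r := by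
  have h0 : 0 < r := by linarith
  have hA := hx.A_nonneg
  have h1 := hx.hA t r hr
  have hs : √r * √r = r := Real.mul_self_sqrt h0.le
  have hsp : 0 < √r := Real.sqrt_pos.2 h0
  have h2 : |w t r| / r ≤ A / √r := by
    rw [div_le_div_iff₀ h0 hsp]
    calc |w t r| * √r ≤ A * √r * √r := by gcongr
      _ = A * r := by rw [mul_assoc, hs]
  have h3 : wr t r + w t r / r = (wr t r - 2 * r / (r ^ 2 + 1) * w t r)
      + (2 * r / (r ^ 2 + 1) + 1 / r) * w t r := by ring
  have h4 : 2 * r / (r ^ 2 + 1) ≤ 2 / r := by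
    rw [div_le_div_iff₀ (by positivity) h0]; nlinarith
  have h5 : |(2 * r / (r ^ 2 + 1) + 1 / r) * w t r| ≤ 3 * A / √r := by
    rw [abs_mul, abs_of_nonneg (by positivity)]
    calc (2 * r / (r ^ 2 + 1) + 1 / r) * |w t r| ≤ (2 / r + 1 / r) * |w t r| := by gcongr
      _ = 3 * (|w t r| / r) := by ring
      _ ≤ 3 * (A / √r) := by gcongr
      _ = 3 * A / √r := by ring
  rw [h3]
  exact (abs_add_le _ _).trans (by linarith)

lemma m_le_E {E : ℝ} (hw : C2Plane w wt wr wtt wtr wrr)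
    (hE : ∀ t a b, 1 ≤ a → a ≤ b → ∫ r in a..b, edens w wt wr t r ≤ E)
    (t : ℝ) {r R : ℝ} (hr : 1 ≤ r) (hR : r ≤ R) :
    |∫ ρ in r..R, kap ρ * wt t ρ| ≤ (E + 1) / √r := by
  have h0 : 0 < r := by linarith
  have hsp : 0 < √r := Real.sqrt_pos.2 h0
  have hs : √r * √r = r := Real.mul_self_sqrt h0.le
  have ce : Continuous (fun ρ => edens w wt wr t ρ) :=
    (edens_cont hw).comp (Continuous.prodMk_right t)
  have ci : IntervalIntegrable (fun ρ : ℝ => √r * (1 / ρ ^ (0 + 2))) volume r R := by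
    refine ContinuousOn.intervalIntegrable ?_
    rw [Set.uIcc_of_le hR]
    refine continuousOn_const.mul (continuousOn_const.div (by fun_prop) ?_)
    intro s hs
    have : 0 < s := by linarith [hs.1]
    positivity
  have ci1 : IntervalIntegrable (fun ρ : ℝ => 1 / √r * edens w wt wr t ρ) volume r R :=
    (ce.intervalIntegrable r R).const_mul _
  have h1 : |∫ ρ in r..R, kap ρ * wt t ρ|
      ≤ ∫ ρ in r..R, (1 / √r * edens w wt wr t ρ + √r * (1 / ρ ^ (0 + 2))) := by
    rw [← Real.norm_eq_abs]
    refine intervalIntegral.norm_integral_le_of_norm_le hR ?_ (ci1.add ci)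
    refine Eventually.of_forall fun s hs => ?_
    have hs0 : 0 < s := by linarith [hs.1]
    rw [kap_eq (by linarith [hs.1]), Real.norm_eq_abs, abs_mul, abs_of_pos (by positivity)]
    have h2 : wt t s ^ 2 ≤ edens w wt wr t s := by unfold edens; nlinarith [sq_nonneg (wr t s - 2 * s / (s ^ 2 + 1) * w t s)]
    have h3 : 1 / s * |wt t s| ≤ 1 / √r * wt t s ^ 2 + √r * (1 / s ^ 2) := by
      have e : 0 ≤ (1 / √r) * (|wt t s| - √r / s) ^ 2 := by positivity
      have e2 : (1 / √r) * (|wt t s| - √r / s) ^ 2 =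
        1 / √r * wt t s ^ 2 + √r * (1 / s ^ 2) - 2 * (1 / s * |wt t s|) := by
        rw [sub_sq, sq_abs]; field_simp; try ring
      have e3 : 0 ≤ 1 / s * |wt t s| := by positivity
      linarith
    calc _ ≤ _ := h3
      _ ≤ _ := by simp only [zero_add]; gcongr
  rw [intervalIntegral.integral_add ci1 ci, intervalIntegral.integral_const_mul,
    intervalIntegral.integral_const_mul] at h1
  have h4 := integral_inv_pow_le 0 h0 hR
  have h5 := hE t r R hr hR
  calc _ ≤ _ := h1
    _ ≤ 1 / √r * E + √r * (1 / r ^ (0 + 1)) := by gcongr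
    _ = (E + 1) / √r := by
      have : √r * (1 / r ^ (0 + 1)) = 1 / √r := by
        rw [zero_add, pow_one]; field_simp; nlinarith
      rw [this]; ring

lemma ExtBound.m_le {A E : ℝ} (hw : C2Plane w wt wr wtt wtr wrr) (hx : ExtBound A E w wt wr)
    (t : ℝ) {r R : ℝ} (hr : 1 ≤ r) (hR : r ≤ R) :
    |∫ ρ in r..R, kap ρ * wt t ρ| ≤ (E + 1) / √r := m_le_E hw hx.hE t hr hR

lemma exists_radius_E {E : ℝ} (hw : C2Plane w wt wr wtt wtr wrr)
    (hE : ∀ t a b, 1 ≤ a → a ≤ b → ∫ r in a..b, edens w wt wr t r ≤ E)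
    {a b : ℝ} (hab : a ≤ b) {Z : ℝ} (hZ1 : 1 ≤ Z) :
    ∃ R ∈ Set.Icc Z (Z + 1), ∫ σ in a..b, edens w wt wr σ R ≤ (b - a) * E + 1 := by
  have ce := edens_cont hw
  have swap : ∫ R in Z..(Z + 1), ∫ σ in a..b, edens w wt wr σ R
      = ∫ σ in a..b, ∫ R in Z..(Z + 1), edens w wt wr σ R := by
    refine intervalIntegral_intervalIntegral_swap (F := fun R σ => edens w wt wr σ R) ?_
    have cc : Continuous (Function.uncurry fun R σ => edens w wt wr σ R) :=
      ce.comp (by fun_prop : Continuous fun p : ℝ × ℝ => (p.2, p.1))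
    refine (cc.continuousOn.integrableOn_compact
      ((isCompact_uIcc (a := Z) (b := Z + 1)).prod (isCompact_uIcc (a := a) (b := b)))).mono_set ?_
    exact Set.prod_mono Set.uIoc_subset_uIcc Set.uIoc_subset_uIcc
  have cI : Continuous (fun R => ∫ σ in a..b, edens w wt wr σ R) :=
    intervalIntegral.continuous_parametric_intervalIntegral_of_continuous'
      (f := fun R σ => edens w wt wr σ R)
      (ce.comp (by fun_prop : Continuous fun p : ℝ × ℝ => (p.2, p.1))) a b
  have cI2 : Continuous (fun σ => ∫ R in Z..(Z + 1), edens w wt wr σ R) :=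
    intervalIntegral.continuous_parametric_intervalIntegral_of_continuous'
      (f := fun σ R => edens w wt wr σ R) ce Z (Z + 1)
  have up : ∫ σ in a..b, ∫ R in Z..(Z + 1), edens w wt wr σ R ≤ (b - a) * E := by
    have := intervalIntegral.integral_mono_on hab (cI2.intervalIntegrable (μ := volume) a b)
      (intervalIntegrable_const (c := E)) (fun σ _ => hE σ Z (Z + 1) hZ1 (by linarith))
    simpa using this
  by_contra! hcon
  have := intervalIntegral.integral_mono_on (by linarith : Z ≤ Z + 1)
      (intervalIntegrable_const (c := (b - a) * E + 1)) (cI.intervalIntegrable (μ := volume) Z (Z + 1))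
      (fun R hR => (hcon R hR).le)
  rw [intervalIntegral.integral_const, swap] at this
  simp only [add_sub_cancel_left, one_smul] at this
  linarith

lemma exists_good_radius {A E : ℝ} (hw : C2Plane w wt wr wtt wtr wrr)
    (hx : ExtBound A E w wt wr) {a b : ℝ} (hab : a ≤ b) (Y ε : ℝ) (hε : 0 < ε) :
    ∃ R, Y ≤ R ∧ 1 ≤ R ∧ ∫ σ in a..b, |wr σ R + w σ R / R| / R ≤ ε := by
  have hA := hx.A_nonneg
  have hE := hx.E_nonneg
  set K : ℝ := (b - a) * (1 + 3 * A) + ((b - a) * E + 1) with hK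
  have hK0 : 0 < K := by
    have : 0 ≤ b - a := by linarith
    positivity
  set Z : ℝ := max (max Y 1) (K / ε) with hZ
  have hZY : Y ≤ Z := (le_max_left _ _).trans (le_max_left _ _)
  have hZ1 : 1 ≤ Z := (le_max_right _ _).trans (le_max_left _ _)
  have hZK : K / ε ≤ Z := le_max_right _ _
  have ce := edens_cont hw
  obtain ⟨R, hR, hRE⟩ := exists_radius_E hw hx.hE hab hZ1
  have hR1 : 1 ≤ R := hZ1.trans hR.1
  refine ⟨R, hZY.trans hR.1, hR1, ?_⟩
  have hRp : 0 < R := by linarith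
  have cw : Continuous (fun σ => |wr σ R + w σ R / R| / R) := by
    have h1 : Continuous (fun σ => wr σ R) := hw.c2.cf.comp (Continuous.prodMk_left R)
    have h2 : Continuous (fun σ => w σ R) := hw.c0.cf.comp (Continuous.prodMk_left R)
    exact ((h1.add (h2.div_const R)).abs).div_const R
  have cE : Continuous (fun σ => edens w wt wr σ R) := ce.comp (Continuous.prodMk_left R)
  have step : ∫ σ in a..b, |wr σ R + w σ R / R| / R
      ≤ ∫ σ in a..b, ((1 + 3 * A) + edens w wt wr σ R) / R := by
    refine intervalIntegral.integral_mono_on hab (cw.intervalIntegrable a b)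
      ((continuous_const.add cE).div_const R |>.intervalIntegrable a b) fun σ _ => ?_
    have h1 := hx.H_le σ hR1
    have h2 : 3 * A / √R ≤ 3 * A := by
      apply div_le_self (by positivity)
      rw [Real.one_le_sqrt]; exact hR1
    have h3 : |wr σ R - 2 * R / (R ^ 2 + 1) * w σ R| ≤ 1 + edens w wt wr σ R := by
      unfold edens
      rw [← sq_abs (wr σ R - 2 * R / (R ^ 2 + 1) * w σ R)]
      nlinarith [sq_nonneg (|wr σ R - 2 * R / (R ^ 2 + 1) * w σ R| - 1), sq_nonneg (wt σ R),
        abs_nonneg (wr σ R - 2 * R / (R ^ 2 + 1) * w σ R)]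
    gcongr
    linarith
  refine step.trans ?_
  rw [intervalIntegral.integral_div, intervalIntegral.integral_add intervalIntegrable_const
    (cE.intervalIntegrable a b), intervalIntegral.integral_const, div_le_iff₀ hRp, smul_eq_mul]
  have : K ≤ ε * R := by
    have := hZK.trans hR.1
    rw [div_le_iff₀ hε] at this
    linarith
  linarith

lemma two_sided {A E : ℝ} (hw : C2Plane w wt wr wtt wtr wrr) (hx : ExtBound A E w wt wr)
    {C R0 : ℝ} (k : ℕ) (hR0 : 1 ≤ R0)
    (hF : ∀ t r, R0 ≤ r → |wtt t r - wrr t r + 2 * w t r / r ^ 2| ≤ C / r ^ (k + 2))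
    {t0 r0 T : ℝ} (hr : R0 ≤ r0) (hT : 0 ≤ T) :
    2 * |wr t0 r0 + w t0 r0 / r0| ≤
      (|wt (t0 + T) (r0 + T)| + |wr (t0 + T) (r0 + T)
          - 2 * (r0 + T) / ((r0 + T) ^ 2 + 1) * w (t0 + T) (r0 + T)|)
      + (|wt (t0 - T) (r0 + T)| + |wr (t0 - T) (r0 + T)
          - 2 * (r0 + T) / ((r0 + T) ^ 2 + 1) * w (t0 - T) (r0 + T)|)
      + 2 * (3 * A + E + 1) / √(r0 + T) + 4 * C / r0 ^ (k + 1) := by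
  refine le_of_forall_pos_le_add fun ε hε => ?_
  obtain ⟨R, hRY, hR1, hRε⟩ := exists_good_radius hw hx (a := t0 - T) (b := t0 + T)
    (by linarith) (r0 + T) (ε / 2) (by linarith)
  have hRp : 0 < R := by linarith
  have h1r : 1 ≤ r0 + T := by linarith
  have c1 := char_estimate hw k hR0 hF (t0 := t0) hr hT hRY
  have c2 := char_estimate hw.rev k hR0 (fun t r h => hF (-t) r h) (t0 := -t0) hr hT hRY
  have cw : Continuous (fun σ => |wr σ R + w σ R / R| / R) := by
    have h1 : Continuous (fun σ => wr σ R) := hw.c2.cf.comp (Continuous.prodMk_left R)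
    have h2 : Continuous (fun σ => w σ R) := hw.c0.cf.comp (Continuous.prodMk_left R)
    exact ((h1.add (h2.div_const R)).abs).div_const R
  have nn : ∀ σ, 0 ≤ |wr σ R + w σ R / R| / R := fun σ => by positivity
  have i1 : ∫ σ in (0 : ℝ)..T, |wr (t0 + σ) R + w (t0 + σ) R / R| / R ≤ ε / 2 := by
    rw [intervalIntegral.integral_comp_add_left (fun σ => |wr σ R + w σ R / R| / R) t0]
    refine le_trans ?_ hRε
    refine intervalIntegral.integral_mono_interval (by linarith) (by linarith) le_rfl
      (Eventually.of_forall nn) (cw.intervalIntegrable _ _)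
  have i2 : ∫ σ in (0 : ℝ)..T, |wr (-(-t0 + σ)) R + w (-(-t0 + σ)) R / R| / R ≤ ε / 2 := by
    have e : ∀ σ, -(-t0 + σ) = t0 - σ := fun σ => by ring
    simp only [e]
    rw [intervalIntegral.integral_comp_sub_left (fun σ => |wr σ R + w σ R / R| / R) t0]
    refine le_trans ?_ hRε
    refine intervalIntegral.integral_mono_interval (by linarith) (by linarith) (by linarith)
      (Eventually.of_forall nn) (cw.intervalIntegrable _ _)
  have m1 := hx.m_le hw (t0 + T) h1r hRY
  have m2 := hx.m_le hw (t0 - T) h1r hRY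
  have H1 := hx.H_le (t0 + T) h1r
  have H2 := hx.H_le (t0 - T) h1r
  have e1 : -(-t0 + T) = t0 - T := by ring
  have e0 : -(-t0) = t0 := by ring
  simp only [e1, e0, mul_neg, intervalIntegral.integral_neg] at c2
  have eD : 2 * (3 * A + E + 1) / √(r0 + T) = 2 * (3 * A / √(r0 + T)) + 2 * ((E + 1) / √(r0 + T)) := by
    ring
  have eC : 4 * C / r0 ^ (k + 1) = 2 * (2 * C / r0 ^ (k + 1)) := by ring
  rw [eD, eC]
  generalize (∫ ρ in r0..R, kap ρ * wt t0 ρ) = M0 at *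
  generalize (∫ ρ in (r0 + T)..R, kap ρ * wt (t0 + T) ρ) = M1 at *
  generalize (∫ ρ in (r0 + T)..R, kap ρ * wt (t0 - T) ρ) = M2 at *
  have X1 : |wt (t0 + T) (r0 + T) - wr (t0 + T) (r0 + T) - w (t0 + T) (r0 + T) / (r0 + T) - M1|
      ≤ |wt (t0 + T) (r0 + T)| + |wr (t0 + T) (r0 + T) + w (t0 + T) (r0 + T) / (r0 + T)| + |M1| := by
    have := abs_sub (wt (t0 + T) (r0 + T)) (wr (t0 + T) (r0 + T) + w (t0 + T) (r0 + T) / (r0 + T))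
    have h2 := abs_sub (wt (t0 + T) (r0 + T) -
      (wr (t0 + T) (r0 + T) + w (t0 + T) (r0 + T) / (r0 + T))) M1
    rw [← sub_sub] at h2 this
    linarith
  have X2 : |-wt (t0 - T) (r0 + T) - wr (t0 - T) (r0 + T) - w (t0 - T) (r0 + T) / (r0 + T) - -M2|
      ≤ |wt (t0 - T) (r0 + T)| + |wr (t0 - T) (r0 + T) + w (t0 - T) (r0 + T) / (r0 + T)| + |M2| := by
    have := abs_sub (-wt (t0 - T) (r0 + T)) (wr (t0 - T) (r0 + T) + w (t0 - T) (r0 + T) / (r0 + T))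
    have h2 := abs_sub (-wt (t0 - T) (r0 + T) -
      (wr (t0 - T) (r0 + T) + w (t0 - T) (r0 + T) / (r0 + T))) (-M2)
    rw [← sub_sub] at h2 this
    rw [abs_neg] at h2 this
    linarith
  have S : 2 * |wr t0 r0 + w t0 r0 / r0| ≤ |wt t0 r0 - wr t0 r0 - w t0 r0 / r0 - M0|
      + |-wt t0 r0 - wr t0 r0 - w t0 r0 / r0 - -M0| := by
    have := abs_add_le (wt t0 r0 - wr t0 r0 - w t0 r0 / r0 - M0)
      (-wt t0 r0 - wr t0 r0 - w t0 r0 / r0 - -M0)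
    have e : (wt t0 r0 - wr t0 r0 - w t0 r0 / r0 - M0)
      + (-wt t0 r0 - wr t0 r0 - w t0 r0 / r0 - -M0) = -(2 * (wr t0 r0 + w t0 r0 / r0)) := by ring
    rw [e, abs_neg, abs_mul, abs_of_pos (by norm_num : (0 : ℝ) < 2)] at this
    exact this
  linarith

/-- The main exterior bound: no radiation forces decay of the conjugated quantity. -/
theorem H_bound {A E : ℝ} (hw : C2Plane w wt wr wtt wtr wrr) (hx : ExtBound A E w wt wr)
    {C R0 : ℝ} (k : ℕ) (hR0 : 1 ≤ R0)
    (hF : ∀ t r, R0 ≤ r → |wtt t r - wrr t r + 2 * w t r / r ^ 2| ≤ C / r ^ (k + 2))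
    {t0 r0 : ℝ} (hr : R0 ≤ r0) : |wr t0 r0 + w t0 r0 / r0| ≤ 2 * C / r0 ^ (k + 1) := by
  by_contra! hcon
  have hA := hx.A_nonneg
  have hE := hx.E_nonneg
  -- continuity
  have c0 : Continuous (w t0) := hw.c0.cf.comp (Continuous.prodMk_right t0)
  have c1 : Continuous (wr t0) := hw.c2.cf.comp (Continuous.prodMk_right t0)
  have hr00 : r0 ≠ 0 := by linarith
  have cat : ContinuousAt (fun r => |wr t0 r + w t0 r / r| - 2 * C / r ^ (k + 1)) r0 :=
    ((c1.continuousAt.add (c0.continuousAt.div continuousAt_id hr00)).abs).sub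
      (continuousAt_const.div (by fun_prop) (pow_ne_zero _ hr00))
  obtain ⟨η, hη, hη2⟩ : ∃ η, 0 < η ∧ η < |wr t0 r0 + w t0 r0 / r0| - 2 * C / r0 ^ (k + 1) :=
    exists_between (by linarith)
  have ev := cat.eventually (lt_mem_nhds hη2)
  obtain ⟨δ, hδ, hball⟩ := Metric.eventually_nhds_iff.1 ev
  set d := δ / 2 with hd
  have hd0 : 0 < d := by positivity
  have hlow : ∀ r ∈ Set.Icc r0 (r0 + d), η < |wr t0 r + w t0 r / r| - 2 * C / r ^ (k + 1) := by
    intro r hr'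
    apply hball
    rw [Real.dist_eq, abs_of_nonneg (by linarith [hr'.1])]
    linarith [hr'.2]
  -- choose T
  set ε := η ^ 2 * d / 32 with hεd
  have hε : 0 < ε := by positivity
  obtain ⟨ρ, hρ1, hρ⟩ := hx.tail ε hε
  set D := 2 * (3 * A + E + 1) with hD
  have hD0 : 0 < D := by positivity
  set T := max ρ ((D / η) ^ 2) with hT
  have hT0 : 0 ≤ T := by have := le_max_left ρ ((D / η) ^ 2); linarith
  have hTρ : ρ ≤ T := le_max_left _ _
  have hTD : (D / η) ^ 2 ≤ T := le_max_right _ _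
  have key : ∀ r ∈ Set.Icc r0 (r0 + d), η ^ 2 / 4 ≤
      edens w wt wr (t0 + T) (r + T) + edens w wt wr (t0 - T) (r + T) := by
    intro r hr'
    have h1 := two_sided hw hx k hR0 hF (t0 := t0) (r0 := r) (T := T) (by linarith [hr'.1]) hT0
    have h2 := hlow r hr'
    have h3 : D / √(r + T) ≤ η := by
      have hrT : (D / η) ^ 2 ≤ r + T := by linarith [hr'.1]
      have : D / η ≤ √(r + T) := Real.le_sqrt_of_sq_le hrT
      have hp : 0 < √(r + T) := lt_of_lt_of_le (by positivity) this
      rw [div_le_iff₀ hp]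
      rw [div_le_iff₀ hη] at this
      linarith
    have eC : 4 * C / r ^ (k + 1) = 2 * (2 * C / r ^ (k + 1)) := by ring
    rw [eC] at h1
    unfold edens
    set a1 := wt (t0 + T) (r + T)
    set a2 := wr (t0 + T) (r + T) - 2 * (r + T) / ((r + T) ^ 2 + 1) * w (t0 + T) (r + T)
    set a3 := wt (t0 - T) (r + T)
    set a4 := wr (t0 - T) (r + T) - 2 * (r + T) / ((r + T) ^ 2 + 1) * w (t0 - T) (r + T)
    have h4 : η ≤ |a1| + |a2| + (|a3| + |a4|) := by linarith
    rw [← sq_abs a1, ← sq_abs a2, ← sq_abs a3, ← sq_abs a4]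
    have h5 : η ^ 2 ≤ (|a1| + |a2| + (|a3| + |a4|)) ^ 2 := by gcongr
    nlinarith [sq_nonneg (|a1| - |a2|), sq_nonneg (|a1| - |a3|), sq_nonneg (|a1| - |a4|),
      sq_nonneg (|a2| - |a3|), sq_nonneg (|a2| - |a4|), sq_nonneg (|a3| - |a4|)]
  have ce : ∀ t, Continuous (fun r => edens w wt wr t (r + T)) := fun t =>
    (edens_cont hw).comp (by fun_prop : Continuous fun r : ℝ => (t, r + T))
  have int := intervalIntegral.integral_mono_on (by linarith : r0 ≤ r0 + d)
    (intervalIntegrable_const (c := η ^ 2 / 4))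
    (((ce (t0 + T)).add (ce (t0 - T))).intervalIntegrable (μ := volume) r0 (r0 + d)) key
  simp only [Pi.add_apply] at int
  rw [intervalIntegral.integral_const, intervalIntegral.integral_add
    ((ce _).intervalIntegrable _ _) ((ce _).intervalIntegrable _ _),
    intervalIntegral.integral_comp_add_right (fun r => edens w wt wr (t0 + T) r),
    intervalIntegral.integral_comp_add_right (fun r => edens w wt wr (t0 - T) r)] at int
  have i1 := hρ (t0 + T) (r0 + T) (r0 + d + T) (by linarith) (by linarith)
  have i2 := hρ (t0 - T) (r0 + T) (r0 + d + T) (by linarith) (by linarith)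
  simp only [smul_eq_mul, add_sub_cancel_left] at int
  have : d * (η ^ 2 / 4) ≤ η ^ 2 * d / 32 + η ^ 2 * d / 32 := by linarith
  have hp : 0 < η ^ 2 * d := by positivity
  linarith

end


section

lemma integral_le_of_integrable {f : ℝ → ℝ} (hf : Integrable f) (h0 : ∀ r, 0 ≤ f r) {a b : ℝ}
    (hab : a ≤ b) : ∫ r in a..b, f r ≤ ∫ r, f r := by
  rw [intervalIntegral.integral_of_le hab]
  exact setIntegral_le_integral hf (Eventually.of_forall h0)

lemma tail_of_integrable {f : ℝ → ℝ} (hf : Integrable f) (h0 : ∀ r, 0 ≤ f r) {ε : ℝ}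
    (hε : 0 < ε) : ∃ ρ, ∀ a b, ρ ≤ a → a ≤ b → ∫ r in a..b, f r ≤ ε := by
  have h1 := intervalIntegral_tendsto_integral_Ioi (0 : ℝ) hf.integrableOn
    (tendsto_id (α := ℝ) (x := atTop))
  have h2 := (h1.eventually (lt_mem_nhds (sub_lt_self (∫ r in Set.Ioi 0, f r) hε))).and
    (eventually_ge_atTop 0)
  obtain ⟨ρ, h3, hρ0⟩ := h2.exists
  refine ⟨ρ, fun a b ha hab => ?_⟩
  have ii : ∀ x y, IntervalIntegrable f volume x y := fun x y => hf.intervalIntegrable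
  have h4 : ∫ r in (0 : ℝ)..b, f r ≤ ∫ r in Set.Ioi 0, f r := by
    rw [intervalIntegral.integral_of_le (by linarith)]
    exact setIntegral_mono_set hf.integrableOn (Eventually.of_forall h0)
      (Eventually.of_forall fun x hx => hx.1)
  have h5 := intervalIntegral.integral_add_adjacent_intervals (ii 0 ρ) (ii ρ a)
  have h6 := intervalIntegral.integral_add_adjacent_intervals (ii 0 a) (ii a b)
  have h7 : 0 ≤ ∫ r in ρ..a, f r := intervalIntegral.integral_nonneg ha fun x _ => h0 x
  simp only [id] at h3
  linarith

lemma energy_of_totallyBounded {u ut ur : ℝ → ℝ → ℝ} (hu : C1Plane u ut ur)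
    (hfin : FiniteEnergyReduced u) (hcomp : TotallyBoundedTraj u) :
    (∃ E, ∀ t a b, a ≤ b → ∫ r in a..b, (ur t r ^ 2 + ut t r ^ 2) * (r ^ 2 + 1) ^ 2 ≤ E) ∧
    ∀ ε, 0 < ε → ∃ ρ, 1 ≤ ρ ∧ ∀ t a b, ρ ≤ a → a ≤ b →
      ∫ r in a..b, (ur t r ^ 2 + ut t r ^ 2) * (r ^ 2 + 1) ^ 2 ≤ ε := by
  have e1 : ∀ t r, deriv (u t) r = ur t r := fun t r => (hu.dr t r).deriv
  have e2 : ∀ t r, deriv (fun s => u s r) t = ut t r := fun t r => (hu.dt t r).deriv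
  unfold FiniteEnergyReduced at hfin
  unfold TotallyBoundedTraj at hcomp
  simp only [e1, e2] at hfin hcomp
  have cr : ∀ t, Continuous (ur t) := fun t => hu.cr.comp (Continuous.prodMk_right t)
  have ct : ∀ t, Continuous (ut t) := fun t => hu.ct.comp (Continuous.prodMk_right t)
  have n0 : ∀ t r, 0 ≤ (ur t r ^ 2 + ut t r ^ 2) * (r ^ 2 + 1) ^ 2 := fun t r => by positivity
  have main : ∀ ε, 0 < ε → ∃ (N : ℕ) (ts : Fin N → ℝ), ∀ t, ∃ i : Fin N, ∀ a b, a ≤ b →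
      ∫ r in a..b, (ur t r ^ 2 + ut t r ^ 2) * (r ^ 2 + 1) ^ 2
       ≤ 2 * ε ^ 2 + 2 * ∫ r in a..b, (ur (ts i) r ^ 2 + ut (ts i) r ^ 2) * (r ^ 2 + 1) ^ 2 := by
    intro ε hε
    obtain ⟨N, ts, h⟩ := hcomp ε hε
    refine ⟨N, ts, fun t => ?_⟩
    obtain ⟨i, hi⟩ := h t
    refine ⟨i, fun a b hab => ?_⟩
    set s := ts i
    have := cr t
    have := cr s
    have := ct t
    have := ct s
    have cd : Continuous (fun r : ℝ => ((ur t r - ur s r) ^ 2 + (ut t r - ut s r) ^ 2) *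
      (r ^ 2 + 1) ^ 2) := by fun_prop
    have d0 : ∀ r : ℝ, 0 ≤ ((ur t r - ur s r) ^ 2 + (ut t r - ut s r) ^ 2) *
      (r ^ 2 + 1) ^ 2 := fun r => by positivity
    have di : Integrable (fun r : ℝ => ((ur t r - ur s r) ^ 2 + (ut t r - ut s r) ^ 2) *
      (r ^ 2 + 1) ^ 2) := by
      refine (((hfin t).const_mul 2).add ((hfin s).const_mul 2)).mono' cd.aestronglyMeasurable ?_
      refine Eventually.of_forall fun r => ?_
      rw [Real.norm_eq_abs, abs_of_nonneg (d0 r)]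
      simp only [Pi.add_apply]
      have : (ur t r - ur s r) ^ 2 + (ut t r - ut s r) ^ 2 ≤
        2 * (ur t r ^ 2 + ut t r ^ 2) + 2 * (ur s r ^ 2 + ut s r ^ 2) := by
        nlinarith [sq_nonneg (ur t r + ur s r), sq_nonneg (ut t r + ut s r)]
      have h2 : (0 : ℝ) ≤ (r ^ 2 + 1) ^ 2 := by positivity
      nlinarith [mul_le_mul_of_nonneg_right this h2]
    have hI : ∫ r, ((ur t r - ur s r) ^ 2 + (ut t r - ut s r) ^ 2) * (r ^ 2 + 1) ^ 2 ≤ ε ^ 2 :=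
      ((Real.sqrt_lt' hε).1 hi).le
    have hI2 := integral_le_of_integrable di d0 hab
    have ii := intervalIntegral.integral_mono_on hab
      ((by fun_prop : Continuous fun r : ℝ => (ur t r ^ 2 + ut t r ^ 2) * (r ^ 2 + 1) ^ 2
        ).intervalIntegrable (μ := volume) a b)
      ((by fun_prop : Continuous fun r : ℝ => 2 * (((ur t r - ur s r) ^ 2 + (ut t r - ut s r) ^ 2) *
      (r ^ 2 + 1) ^ 2) + 2 * ((ur s r ^ 2 + ut s r ^ 2) * (r ^ 2 + 1) ^ 2)
        ).intervalIntegrable (μ := volume) a b)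
      (fun r _ => by
        have : ur t r ^ 2 + ut t r ^ 2 ≤
          2 * ((ur t r - ur s r) ^ 2 + (ut t r - ut s r) ^ 2) + 2 * (ur s r ^ 2 + ut s r ^ 2) := by
          nlinarith [sq_nonneg (ur t r - 2 * ur s r), sq_nonneg (ut t r - 2 * ut s r)]
        have h2 : (0 : ℝ) ≤ (r ^ 2 + 1) ^ 2 := by positivity
        nlinarith [mul_le_mul_of_nonneg_right this h2])
    rw [intervalIntegral.integral_add (Continuous.intervalIntegrable (by fun_prop) _ _)
      (Continuous.intervalIntegrable (by fun_prop) _ _), intervalIntegral.integral_const_mul,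
      intervalIntegral.integral_const_mul] at ii
    linarith
  constructor
  · obtain ⟨N, ts, h⟩ := main 1 one_pos
    refine ⟨2 + 2 * ∑ i, ∫ r, (ur (ts i) r ^ 2 + ut (ts i) r ^ 2) * (r ^ 2 + 1) ^ 2,
      fun t a b hab => ?_⟩
    obtain ⟨i, hi⟩ := h t
    have h1 := hi a b hab
    have h2 := integral_le_of_integrable (hfin (ts i)) (n0 _) hab
    have h3 := Finset.single_le_sum (f := fun i => ∫ r, (ur (ts i) r ^ 2 + ut (ts i) r ^ 2) *
      (r ^ 2 + 1) ^ 2) (fun i _ => integral_nonneg (n0 (ts i))) (Finset.mem_univ i)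
    linarith
  · intro ε hε
    obtain ⟨N, ts, h⟩ := main (√(ε / 4)) (by positivity)
    have hs : √(ε / 4) ^ 2 = ε / 4 := Real.sq_sqrt (by positivity)
    choose ρ hρ using fun i => tail_of_integrable (hfin (ts i)) (n0 _)
      (by linarith : (0 : ℝ) < ε / 4)
    refine ⟨1 + ∑ i, |ρ i|, ?_, fun t a b ha hab => ?_⟩
    · have : 0 ≤ ∑ i, |ρ i| := Finset.sum_nonneg fun i _ => abs_nonneg _
      linarith
    obtain ⟨i, hi⟩ := h t
    have h1 := hi a b hab
    have h3 := Finset.single_le_sum (f := fun i => |ρ i|) (fun i _ => abs_nonneg _)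
      (Finset.mem_univ i)
    have h4 := hρ i a b (by linarith [le_abs_self (ρ i)]) hab
    rw [hs] at h1
    linarith

end


section

variable {w wt wr wtt wtr wrr : ℝ → ℝ → ℝ}

/-- oscillation of `u = w/(r²+1)` is controlled by the energy -/
lemma osc_u {E : ℝ} (hw : C2Plane w wt wr wtt wtr wrr)
    (hE : ∀ t a b, 1 ≤ a → a ≤ b → ∫ r in a..b, edens w wt wr t r ≤ E)
    (t : ℝ) {r0 r : ℝ} (h1 : 1 ≤ r0) (hr : r0 ≤ r) :
    |w t r / (r ^ 2 + 1) - w t r0 / (r0 ^ 2 + 1)| ≤ (E + 1) / (r0 * √r0) := by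
  have h0 : 0 < r0 := by linarith
  have hsp : 0 < √r0 := Real.sqrt_pos.2 h0
  have hs : √r0 * √r0 = r0 := Real.mul_self_sqrt h0.le
  set s := √r0 with hsdef
  have cw : Continuous (w t) := hw.c0.cf.comp (Continuous.prodMk_right t)
  have cwr : Continuous (wr t) := hw.c2.cf.comp (Continuous.prodMk_right t)
  have hd : ∀ ρ ∈ Set.uIcc r0 r, HasDerivAt (fun ρ => w t ρ / (ρ ^ 2 + 1))
      ((wr t ρ - 2 * ρ / (ρ ^ 2 + 1) * w t ρ) / (ρ ^ 2 + 1)) ρ := by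
    intro ρ _
    have h1 : HasDerivAt (fun ρ : ℝ => ρ ^ 2 + 1) (2 * ρ) ρ := by
      simpa using (hasDerivAt_pow 2 ρ).add_const (1 : ℝ)
    have hp : ρ ^ 2 + 1 ≠ 0 := by positivity
    refine ((hw.c0.dr t ρ).div h1 hp).congr_deriv ?_
    field_simp
  have c1 : Continuous (fun ρ => (wr t ρ - 2 * ρ / (ρ ^ 2 + 1) * w t ρ) / (ρ ^ 2 + 1)) := by
    have h4 : Continuous (fun ρ : ℝ => 2 * ρ / (ρ ^ 2 + 1)) :=
      Continuous.div (by fun_prop) (by fun_prop) (fun p => by positivity)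
    exact Continuous.div (by fun_prop) (by fun_prop) (fun p => by positivity)
  rw [← intervalIntegral.integral_eq_sub_of_hasDerivAt hd (c1.intervalIntegrable _ _)]
  have ce : Continuous (fun ρ => edens w wt wr t ρ) :=
    (edens_cont hw).comp (Continuous.prodMk_right t)
  have ci : IntervalIntegrable (fun ρ : ℝ => (r0 * s) * (1 / ρ ^ (2 + 2))) volume r0 r := by
    refine ContinuousOn.intervalIntegrable ?_
    rw [Set.uIcc_of_le hr]
    refine continuousOn_const.mul (continuousOn_const.div (by fun_prop) ?_)
    intro s hs
    have : 0 < s := by linarith [hs.1]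
    positivity
  have ci1 : IntervalIntegrable (fun ρ : ℝ => 1 / (r0 * s) * edens w wt wr t ρ) volume r0 r :=
    (ce.intervalIntegrable r0 r).const_mul _
  have h2 : |∫ ρ in r0..r, (wr t ρ - 2 * ρ / (ρ ^ 2 + 1) * w t ρ) / (ρ ^ 2 + 1)|
      ≤ ∫ ρ in r0..r, (1 / (r0 * s) * edens w wt wr t ρ + (r0 * s) * (1 / ρ ^ (2 + 2))) := by
    rw [← Real.norm_eq_abs]
    refine intervalIntegral.norm_integral_le_of_norm_le hr ?_ (ci1.add ci)
    refine Eventually.of_forall fun ρ hρ => ?_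
    have hρ0 : 0 < ρ := by linarith [hρ.1]
    rw [Real.norm_eq_abs, abs_div, abs_of_pos (by positivity : 0 < ρ ^ 2 + 1)]
    set q := wr t ρ - 2 * ρ / (ρ ^ 2 + 1) * w t ρ with hq
    have h2 : q ^ 2 ≤ edens w wt wr t ρ := by
      unfold edens; nlinarith [sq_nonneg (wt t ρ)]
    have h3 : |q| / (ρ ^ 2 + 1) ≤ |q| * (1 / ρ ^ 2) := by
      rw [mul_one_div]; gcongr; linarith
    have hrs : 0 < r0 * s := by positivity
    have h4 : |q| * (1 / ρ ^ 2) ≤ 1 / (r0 * s) * q ^ 2 + (r0 * s) * (1 / ρ ^ (2 + 2)) := by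
      have e : 0 ≤ (1 / (r0 * s)) * (|q| - (r0 * s) / ρ ^ 2) ^ 2 := by positivity
      have e2 : (1 / (r0 * s)) * (|q| - (r0 * s) / ρ ^ 2) ^ 2 =
        1 / (r0 * s) * q ^ 2 + (r0 * s) * (1 / ρ ^ (2 + 2)) - 2 * (|q| * (1 / ρ ^ 2)) := by
        rw [sub_sq, sq_abs]; field_simp; try ring
      have e3 : 0 ≤ |q| * (1 / ρ ^ 2) := by positivity
      linarith
    calc _ ≤ _ := h3.trans h4
      _ ≤ _ := by gcongr
  rw [intervalIntegral.integral_add ci1 ci, intervalIntegral.integral_const_mul,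
    intervalIntegral.integral_const_mul] at h2
  have h4 := integral_inv_pow_le 2 h0 hr
  have h5 := hE t r0 r h1 hr
  calc _ ≤ _ := h2
    _ ≤ 1 / (r0 * s) * E + (r0 * s) * (1 / r0 ^ (2 + 1)) := by gcongr
    _ = (E + 1) / (r0 * s) := by
      have : (r0 * s) * (1 / r0 ^ (2 + 1)) = 1 / (r0 * s) := by
        rw [mul_one_div, div_eq_div_iff (by positivity) (by positivity)]
        calc r0 * s * (r0 * s) = r0 ^ 2 * (s * s) := by ring
          _ = 1 * r0 ^ (2 + 1) := by rw [hs]; ring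
      rw [this]; ring

lemma no_positive_limit {E : ℝ} (hw : C2Plane w wt wr wtt wtr wrr)
    (hE : ∀ t a b, 1 ≤ a → a ≤ b → ∫ r in a..b, edens w wt wr t r ≤ E)
    (hG : ∀ t r, 1 ≤ r → |wtt t r - wrr t r| ≤ 2 / r + |w t r| / r ^ 4)
    {t0 r0 : ℝ} (h1 : 1 ≤ r0) : w t0 r0 / (r0 ^ 2 + 1) ≤ (E + 1) / (r0 * √r0) := by
  by_contra! hcon
  have h0 : 0 < r0 := by linarith
  set B := (E + 1) / (r0 * √r0) with hB
  have hE0 : 0 ≤ E := by simpa using hE 0 1 1 le_rfl le_rfl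
  obtain ⟨c, hc1, hc2⟩ := exists_between hcon
  have cat : ContinuousAt (fun t => w t r0 / (r0 ^ 2 + 1)) t0 :=
    ((hw.c0.cf.comp (Continuous.prodMk_left r0)).div_const _).continuousAt
  obtain ⟨δ', hδ', hball⟩ := Metric.eventually_nhds_iff.1 (cat.eventually (lt_mem_nhds hc2))
  set η := δ' / 2 with hη
  have hη0 : 0 < η := by positivity
  set δ := c - B with hδ
  have hδ0 : 0 < δ := by linarith
  have wpos : ∀ t ∈ Set.Icc t0 (t0 + η), ∀ r, r0 ≤ r → δ * r ^ 2 ≤ w t r := by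
    intro t ht r hr
    have h2 : c < w t r0 / (r0 ^ 2 + 1) := hball (by
      rw [Real.dist_eq, abs_of_nonneg (by linarith [ht.1])]; linarith [ht.2])
    have h3 := (abs_le.1 (osc_u hw hE t h1 hr)).1
    have h4 : δ ≤ w t r / (r ^ 2 + 1) := by linarith
    rw [le_div_iff₀ (by positivity)] at h4
    nlinarith
  -- constants
  have ch : Continuous (fun t => (wr t r0 + w t r0 / r0) / r0) := by
    have h1 : Continuous (fun σ => wr σ r0) := hw.c2.cf.comp (Continuous.prodMk_left r0)
    have h2 : Continuous (fun σ => w σ r0) := hw.c0.cf.comp (Continuous.prodMk_left r0)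
    exact ((h1.add (h2.div_const r0))).div_const r0
  set c0 := ∫ t in t0..(t0 + η), (wr t r0 + w t r0 / r0) / r0 with hc0
  have key : ∀ Z, r0 ≤ Z → η * (δ * (Real.log Z - Real.log r0)) ≤
      2 * ((E + 1) / √r0) + 3 * η + η * E + 1 + c0 := by
    intro Z hZ
    obtain ⟨R, hR, hRE⟩ := exists_radius_E hw hE (a := t0) (b := t0 + η) (by linarith)
      (h1.trans hZ)
    have hrR : r0 ≤ R := hZ.trans hR.1
    have hR0 : 0 < R := by linarith
    have hlog : Real.log Z ≤ Real.log R := Real.log_le_log (by linarith) hR.1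
    have cek : Continuous (fun t => edens w wt wr t R) :=
      (edens_cont hw).comp (Continuous.prodMk_left R)
    have m1 := m_le_E hw hE t0 h1 hrR
    have m2 := m_le_E hw hE (t0 + η) h1 hrR
    have ck : Continuous (fun p : ℝ × ℝ => kap p.2) := kap_cont.comp continuous_snd
    have cct : Continuous (fun t => ∫ ρ in r0..R, kap ρ * wtt t ρ) :=
      intervalIntegral.continuous_parametric_intervalIntegral_of_continuous'
        (f := fun t ρ => kap ρ * wtt t ρ) (ck.mul hw.c1.ct) r0 R
    have hder : ∀ t ∈ Set.uIcc t0 (t0 + η), HasDerivAt (fun t => ∫ ρ in r0..R, kap ρ * wt t ρ)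
        (∫ ρ in r0..R, kap ρ * wtt t ρ) t := fun t _ =>
      C1Plane.hasDerivAt_param (f := fun t ρ => kap ρ * wt t ρ) (ft := fun t ρ => kap ρ * wtt t ρ)
        (ck.mul hw.c1.cf) (ck.mul hw.c1.ct)
        (fun t r => (hw.c1.dt t r).const_mul _) r0 R t
    have ftc := intervalIntegral.integral_eq_sub_of_hasDerivAt hder (cct.intervalIntegrable _ _)
    have mono := intervalIntegral.integral_mono_on (by linarith : t0 ≤ t0 + η)
      ((((continuous_const (y := δ * (Real.log R - Real.log r0) - 3)).sub cek).sub
        ch).intervalIntegrable (μ := volume) t0 (t0 + η))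
      (cct.intervalIntegrable (μ := volume) t0 (t0 + η))
      (fun t ht => by
        rw [flux_identity hw h1 hrR]
        have p1 : δ * (Real.log R - Real.log r0) - 2 ≤
            ∫ ρ in r0..R, (wtt t ρ - wrr t ρ + 2 * w t ρ / ρ ^ 2) / ρ := by
          have ic : IntervalIntegrable (fun ρ => (wtt t ρ - wrr t ρ + 2 * w t ρ / ρ ^ 2) / ρ)
              volume r0 R := by
            refine ContinuousOn.intervalIntegrable ?_
            rw [Set.uIcc_of_le hrR]
            have q1 : Continuous (w t) := hw.c0.cf.comp (Continuous.prodMk_right t)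
            have q2 : Continuous (wtt t) := hw.c1.ct.comp (Continuous.prodMk_right t)
            have q3 : Continuous (wrr t) := hw.c2.cr.comp (Continuous.prodMk_right t)
            have q4 : ∀ x ∈ Set.Icc r0 R, x ≠ 0 := fun x hx => by linarith [hx.1]
            exact ContinuousOn.div (ContinuousOn.add (by fun_prop)
              (ContinuousOn.div (by fun_prop) (by fun_prop) fun x hx => pow_ne_zero _ (q4 x hx)))
              (by fun_prop) q4
          have ic1 : IntervalIntegrable (fun ρ : ℝ => δ * ρ⁻¹) volume r0 R := by
            refine ContinuousOn.intervalIntegrable ?_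
            rw [Set.uIcc_of_le hrR]
            exact continuousOn_const.mul (continuousOn_id.inv₀ fun x hx => by
              simp only [id]; linarith [hx.1])
          have ic2 : IntervalIntegrable (fun ρ : ℝ => 2 * (1 / ρ ^ (0 + 2))) volume r0 R := by
            refine ContinuousOn.intervalIntegrable ?_
            rw [Set.uIcc_of_le hrR]
            refine continuousOn_const.mul (continuousOn_const.div (by fun_prop) ?_)
            intro s hs
            have : 0 < s := by linarith [hs.1]
            positivity
          have mm := intervalIntegral.integral_mono_on hrR (ic1.sub ic2) ic (fun ρ hρ => by
            have g1 := hG t ρ (h1.trans hρ.1)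
            have g2 := wpos t ht ρ hρ.1
            have hρ0 : 0 < ρ := by linarith [hρ.1]
            have hρ1 : 1 ≤ ρ := by linarith [hρ.1]
            have g3 : 0 ≤ w t ρ := le_trans (by positivity) g2
            rw [abs_of_nonneg g3] at g1
            have g4 := (abs_le.1 g1).1
            have g5 : w t ρ / ρ ^ 4 ≤ w t ρ / ρ ^ 2 := by
              gcongr w t ρ / ?_
              exact pow_le_pow_right₀ hρ1 (by norm_num)
            have g6 : δ ≤ w t ρ / ρ ^ 2 := by rw [le_div_iff₀ (by positivity)]; exact g2
            have g7 : δ - 2 / ρ ≤ wtt t ρ - wrr t ρ + 2 * w t ρ / ρ ^ 2 := by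
              rw [mul_div_assoc]; linarith
            have g8 : δ * ρ⁻¹ - 2 * (1 / ρ ^ (0 + 2)) = (δ - 2 / ρ) / ρ := by
              field_simp
              try ring
            rw [g8]
            gcongr)
          rw [intervalIntegral.integral_sub ic1 ic2, intervalIntegral.integral_const_mul,
            intervalIntegral.integral_const_mul, integral_inv_of_pos h0 hR0,
            Real.log_div hR0.ne' h0.ne'] at mm
          have n1 := integral_inv_pow_le 0 h0 hrR
          have n2 : 1 / r0 ^ (0 + 1) ≤ 1 := by
            rw [zero_add, pow_one, div_le_one h0]; exact h1
          linarith
        have p2 : -1 - edens w wt wr t R ≤ (wr t R + w t R / R) / R := by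
          have g2 := wpos t ht R hrR
          have g3 : 0 ≤ w t R := le_trans (by positivity) g2
          have e : (wr t R + w t R / R) / R = (wr t R - 2 * R / (R ^ 2 + 1) * w t R) / R +
            (2 * R / (R ^ 2 + 1) * w t R + w t R / R) / R := by ring
          have g4 : 0 ≤ (2 * R / (R ^ 2 + 1) * w t R + w t R / R) / R := by positivity
          set q := (wr t R - 2 * R / (R ^ 2 + 1) * w t R) with hq
          have g5 : q ^ 2 ≤ edens w wt wr t R := by
            unfold edens; nlinarith [sq_nonneg (wt t R)]
          have g6 : -1 - q ^ 2 ≤ q / R := by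
            rw [le_div_iff₀ hR0]
            nlinarith [sq_nonneg (q + 1), sq_nonneg q, mul_nonneg (sq_nonneg q) (by linarith : 0 ≤ R - 1)]
          linarith
        simp only [Pi.sub_apply]
        linarith)
    have ccc : Continuous (fun t => δ * (Real.log R - Real.log r0) - 3 - edens w wt wr t R) :=
      continuous_const.sub cek
    simp only [Pi.sub_apply] at mono
    rw [ftc, intervalIntegral.integral_sub (ccc.intervalIntegrable _ _)
      (ch.intervalIntegrable _ _), intervalIntegral.integral_sub intervalIntegrable_const
      (cek.intervalIntegrable _ _), intervalIntegral.integral_const] at mono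
    simp only [add_sub_cancel_left, smul_eq_mul] at mono hRE
    have a1 := abs_le.1 m1
    have a2 := abs_le.1 m2
    have : η * (δ * (Real.log Z - Real.log r0)) ≤ η * (δ * (Real.log R - Real.log r0)) := by
      gcongr
    nlinarith
  -- contradiction
  have lim : Tendsto (fun Z => η * (δ * (Real.log Z - Real.log r0))) atTop atTop :=
    ((tendsto_atTop_add_const_right _ (-Real.log r0) Real.tendsto_log_atTop).const_mul_atTop
      hδ0).const_mul_atTop hη0
  obtain ⟨Z, hZ1, hZ2⟩ := ((lim.eventually_gt_atTop
    (2 * ((E + 1) / √r0) + 3 * η + η * E + 1 + c0)).and (eventually_ge_atTop r0)).exists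
  linarith [key Z hZ2]

lemma C2Plane.neg (hw : C2Plane w wt wr wtt wtr wrr) :
    C2Plane (fun t r => - w t r) (fun t r => - wt t r) (fun t r => - wr t r)
      (fun t r => - wtt t r) (fun t r => - wtr t r) (fun t r => - wrr t r) :=
  ⟨hw.c0.neg, hw.c1.neg, hw.c2.neg⟩

theorem w_bound {E : ℝ} (hw : C2Plane w wt wr wtt wtr wrr)
    (hE : ∀ t a b, 1 ≤ a → a ≤ b → ∫ r in a..b, edens w wt wr t r ≤ E)
    (hG : ∀ t r, 1 ≤ r → |wtt t r - wrr t r| ≤ 2 / r + |w t r| / r ^ 4)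
    (t r : ℝ) (hr : 1 ≤ r) : |w t r| ≤ 2 * (E + 1) * √r := by
  have h1 := no_positive_limit hw hE hG (t0 := t) hr
  have he : ∀ t r, edens (fun t r => - w t r) (fun t r => - wt t r) (fun t r => - wr t r) t r
    = edens w wt wr t r := by intro t r; unfold edens; ring
  have h2 := no_positive_limit hw.neg (by simpa only [he] using hE)
    (fun t r hr => by
      have := hG t r hr
      rw [abs_neg, ← abs_neg]
      convert this using 2
      ring) (t0 := t) hr
  have h0 : 0 < r := by linarith
  have hsp : 0 < √r := Real.sqrt_pos.2 h0
  have hs : √r * √r = r := Real.mul_self_sqrt h0.le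
  have h3 : |w t r / (r ^ 2 + 1)| ≤ (E + 1) / (r * √r) := by
    rw [abs_le]; constructor
    · rw [neg_div] at h2; linarith
    · exact h1
  rw [abs_div, abs_of_pos (by positivity : 0 < r ^ 2 + 1), div_le_div_iff₀ (by positivity)
    (by positivity)] at h3
  have hE0 : 0 ≤ E := by simpa using hE 0 1 1 le_rfl le_rfl
  have h4 : |w t r| * (r * √r) ≤ (2 * (E + 1) * √r) * (r * √r) := by
    calc _ ≤ _ := h3
      _ ≤ (E + 1) * (2 * r ^ 2) := by gcongr; nlinarith
      _ = 2 * (E + 1) * r * (√r * √r) := by rw [hs]; ring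
      _ = _ := by ring
  exact le_of_mul_le_mul_right h4 (by positivity)

end


section

lemma mono_of {f f' : ℝ → ℝ} {D : Set ℝ} (hD : Convex ℝ D) (h : ∀ x, HasDerivAt f (f' x) x)
    (h0 : ∀ x ∈ interior D, 0 ≤ f' x) : MonotoneOn f D :=
  monotoneOn_of_hasDerivWithinAt_nonneg hD
    (fun x _ => (h x).continuousAt.continuousWithinAt) (fun x _ => (h x).hasDerivWithinAt) h0

lemma anti_of {f f' : ℝ → ℝ} {D : Set ℝ} (hD : Convex ℝ D) (h : ∀ x, HasDerivAt f (f' x) x)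
    (h0 : ∀ x ∈ interior D, f' x ≤ 0) : AntitoneOn f D :=
  antitoneOn_of_hasDerivWithinAt_nonpos hD
    (fun x _ => (h x).continuousAt.continuousWithinAt) (fun x _ => (h x).hasDerivWithinAt) h0

/-- hyperbolic tangent -/
noncomputable def th (x : ℝ) : ℝ := Real.sinh x / Real.cosh x

lemma th_lt {x y : ℝ} (h : x < y) : th x < th y := by
  unfold th
  rw [div_lt_div_iff₀ (Real.cosh_pos _) (Real.cosh_pos _)]
  have : Real.sinh (x - y) < 0 := Real.sinh_neg_iff.2 (by linarith)
  rw [Real.sinh_sub] at this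
  linarith

lemma th_nonneg {x : ℝ} (h : 0 ≤ x) : 0 ≤ th x :=
  div_nonneg (Real.sinh_nonneg_iff.2 h) (Real.cosh_pos _).le

lemma th_nonpos {x : ℝ} (h : x ≤ 0) : th x ≤ 0 :=
  div_nonpos_of_nonpos_of_nonneg (Real.sinh_nonpos_iff.2 h) (Real.cosh_pos _).le

lemma abs_th_le (x : ℝ) : |th x| ≤ 1 := by
  unfold th
  rw [abs_div, abs_of_pos (Real.cosh_pos x), div_le_one (Real.cosh_pos x)]
  exact abs_le_of_sq_le_sq (by have := Real.cosh_sq x; linarith) (Real.cosh_pos x).le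

/-- damped pendulum orbit connecting `0` to `nπ`. -/
structure Pend (n : ℕ) (P p : ℝ → ℝ) : Prop where
  d0 : ∀ x, HasDerivAt P (p x) x
  d1 : ∀ x, HasDerivAt p (Real.sin (2 * P x) - th x * p x) x
  lb : Tendsto P atBot (nhds 0)
  lt : Tendsto P atTop (nhds ((n : ℝ) * π))

namespace Pend
variable {n : ℕ} {P p : ℝ → ℝ}

lemma dW (h : Pend n P p) (x : ℝ) :
    HasDerivAt (fun x => p x ^ 2 / 2 - Real.sin (P x) ^ 2) (- th x * p x ^ 2) x := by
  refine ((((h.d1 x).pow 2).div_const 2).sub ((h.d0 x).sin.pow 2)).congr_deriv ?_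
  rw [Real.sin_two_mul]; push_cast; ring

lemma W_anti (h : Pend n P p) :
    AntitoneOn (fun x => p x ^ 2 / 2 - Real.sin (P x) ^ 2) (Set.Ici 0) :=
  anti_of (convex_Ici 0) h.dW fun x hx => by
    rw [interior_Ici] at hx
    nlinarith [th_nonneg hx.le, sq_nonneg (p x), mul_nonneg (th_nonneg hx.le) (sq_nonneg (p x))]

lemma W_mono (h : Pend n P p) :
    MonotoneOn (fun x => p x ^ 2 / 2 - Real.sin (P x) ^ 2) (Set.Iic 0) :=
  mono_of (convex_Iic 0) h.dW fun x hx => by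
    rw [interior_Iic] at hx
    nlinarith [mul_nonneg (neg_nonneg.2 (th_nonpos hx.le)) (sq_nonneg (p x))]

lemma W_nonneg (h : Pend n P p) (x : ℝ) : Real.sin (P x) ^ 2 ≤ p x ^ 2 / 2 := by
  by_contra! hc
  rcases le_total 0 x with hx | hx
  · have h1 : Tendsto (fun x => Real.sin (P x) ^ 2) atTop (nhds (Real.sin ((n : ℝ) * π) ^ 2)) :=
      ((Real.continuous_sin.tendsto _).comp h.lt).pow 2
    rw [Real.sin_nat_mul_pi] at h1
    obtain ⟨y, h2, h3⟩ := ((h1.eventually (gt_mem_nhds (by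
      linarith : (0 : ℝ) ^ 2 < Real.sin (P x) ^ 2 - p x ^ 2 / 2))).and (eventually_ge_atTop x)).exists
    have h4 := h.W_anti hx (hx.trans h3) h3
    simp only at h4
    nlinarith [sq_nonneg (p y)]
  · have h1 : Tendsto (fun x => Real.sin (P x) ^ 2) atBot (nhds (Real.sin 0 ^ 2)) :=
      ((Real.continuous_sin.tendsto _).comp h.lb).pow 2
    rw [Real.sin_zero] at h1
    obtain ⟨y, h2, h3⟩ := ((h1.eventually (gt_mem_nhds (by
      linarith : (0 : ℝ) ^ 2 < Real.sin (P x) ^ 2 - p x ^ 2 / 2))).and (eventually_le_atBot x)).exists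
    have h4 := h.W_mono (le_trans h3 hx : y ≤ 0) hx h3
    simp only at h4
    nlinarith [sq_nonneg (p y)]

lemma p_top (h : Pend n P p) : Tendsto p atTop (nhds 0) := by
  rw [Metric.tendsto_atTop]
  intro ε hε
  have h1 : Tendsto (fun x => Real.sin (P x) ^ 2) atTop (nhds (Real.sin ((n : ℝ) * π) ^ 2)) :=
      ((Real.continuous_sin.tendsto _).comp h.lt).pow 2
  rw [Real.sin_nat_mul_pi] at h1
  have h2 : Tendsto (fun x => P (x + 1) - P x) atTop (nhds 0) := by
    simpa using (h.lt.comp (tendsto_atTop_add_const_right _ 1 tendsto_id)).sub h.lt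
  have e1 := h1.eventually (gt_mem_nhds (by rw [zero_pow two_ne_zero]; positivity : (0 : ℝ) ^ 2 < ε ^ 2 / 4))
  have e2 := h2.eventually (Metric.ball_mem_nhds 0 (by positivity : 0 < ε / 2))
  obtain ⟨X, hX⟩ := eventually_atTop.1 (e1.and (e2.and (eventually_ge_atTop 0)))
  refine ⟨X + 1, fun y hy => ?_⟩
  obtain ⟨-, hX1, hX0⟩ := hX X le_rfl
  obtain ⟨ξ, hξ, hξ2⟩ := exists_hasDerivAt_eq_slope P p (by linarith : X < X + 1)
    (fun x _ => (h.d0 x).continuousAt.continuousWithinAt) (fun x _ => h.d0 x)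
  have hX1' : |P (X + 1) - P X| < ε / 2 := by simpa [Real.dist_eq] using hX1
  rw [add_sub_cancel_left, div_one] at hξ2
  rw [← hξ2] at hX1'
  have h4 := h.W_anti (show (0 : ℝ) ≤ ξ by linarith [hξ.1]) (show (0 : ℝ) ≤ y by linarith)
    (show ξ ≤ y by linarith [hξ.2])
  simp only at h4
  have h5 := (hX y (by linarith)).1
  rw [Real.dist_eq, sub_zero]
  apply abs_lt_of_sq_lt_sq _ hε.le
  have h6 : p ξ ^ 2 < (ε / 2) ^ 2 := by
    rw [← sq_abs]; exact pow_lt_pow_left₀ hX1' (abs_nonneg _) (by norm_num)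
  nlinarith [sq_nonneg (Real.sin (P ξ))]

lemma p_bot (h : Pend n P p) : Tendsto p atBot (nhds 0) := by
  rw [Metric.tendsto_nhds]
  intro ε hε
  have h1 : Tendsto (fun x => Real.sin (P x) ^ 2) atBot (nhds (Real.sin 0 ^ 2)) :=
      ((Real.continuous_sin.tendsto _).comp h.lb).pow 2
  rw [Real.sin_zero] at h1
  have h2 : Tendsto (fun x => P x - P (x - 1)) atBot (nhds 0) := by
    simpa [sub_eq_add_neg] using h.lb.sub (h.lb.comp (tendsto_atBot_add_const_right _ (-1) tendsto_id))
  have e1 := h1.eventually (gt_mem_nhds (by rw [zero_pow two_ne_zero]; positivity : (0 : ℝ) ^ 2 < ε ^ 2 / 4))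
  have e2 := h2.eventually (Metric.ball_mem_nhds 0 (by positivity : 0 < ε / 2))
  obtain ⟨X, hX⟩ := eventually_atBot.1 (e1.and (e2.and (eventually_le_atBot 0)))
  refine eventually_atBot.2 ⟨X - 1, fun y hy => ?_⟩
  obtain ⟨-, hX1, hX0⟩ := hX X le_rfl
  obtain ⟨ξ, hξ, hξ2⟩ := exists_hasDerivAt_eq_slope P p (by linarith : X - 1 < X)
    (fun x _ => (h.d0 x).continuousAt.continuousWithinAt) (fun x _ => h.d0 x)
  have hX1' : |P X - P (X - 1)| < ε / 2 := by simpa [Real.dist_eq] using hX1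
  rw [sub_sub_cancel, div_one] at hξ2
  rw [← hξ2] at hX1'
  have h4 := h.W_mono (show y ≤ 0 by linarith) (show ξ ≤ 0 by linarith [hξ.2])
    (show y ≤ ξ by linarith [hξ.1])
  simp only at h4
  have h5 := (hX y (by linarith)).1
  rw [Real.dist_eq, sub_zero]
  apply abs_lt_of_sq_lt_sq _ hε.le
  have h6 : p ξ ^ 2 < (ε / 2) ^ 2 := by
    rw [← sq_abs]; exact pow_lt_pow_left₀ hX1' (abs_nonneg _) (by norm_num)
  nlinarith [sq_nonneg (Real.sin (P ξ))]

lemma const_of_zero (h : Pend n P p) {x0 : ℝ} (h0 : p x0 = 0) : ∀ x, P x = 0 := by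
  have h1 := h.W_nonneg x0
  rw [h0] at h1
  have h2 : Real.sin (P x0) = 0 := by
    have : Real.sin (P x0) ^ 2 ≤ 0 := by simpa using h1
    exact pow_eq_zero_iff (two_ne_zero) |>.1 (le_antisymm this (sq_nonneg _))
  obtain ⟨k, hk⟩ := Real.sin_eq_zero_iff.1 h2
  set G : ℝ → ℝ := fun x => (P x - k * π) ^ 2 + p x ^ 2 with hG
  set G' : ℝ → ℝ := fun x => 2 * (P x - k * π) * p x + 2 * p x * (Real.sin (2 * P x) - th x * p x)
    with hG'
  have dG : ∀ x, HasDerivAt G (G' x) x := fun x => by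
    refine ((((h.d0 x).sub_const (k * π)).pow 2).add ((h.d1 x).pow 2)).congr_deriv ?_
    rw [hG']; push_cast; ring
  have bd : ∀ x, |G' x| ≤ 8 * G x := fun x => by
    have hs : |Real.sin (2 * P x)| ≤ 2 * |P x - k * π| := by
      have e : Real.sin (2 * P x) = Real.sin (2 * (P x - k * π)) := by
        have : 2 * P x = 2 * (P x - k * π) + k * (2 * π) := by ring
        rw [this, Real.sin_add_int_mul_two_pi]
      rw [e]
      refine (Real.abs_sin_le_abs).trans ?_
      rw [abs_mul, abs_of_pos (by norm_num : (0 : ℝ) < 2)]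
    have ht := abs_th_le x
    rw [hG', hG]
    simp only
    have : |2 * (P x - k * π) * p x + 2 * p x * (Real.sin (2 * P x) - th x * p x)| ≤
      2 * |P x - k * π| * |p x| + 2 * |p x| * (2 * |P x - k * π| + 1 * |p x|) := by
      refine (abs_add_le _ _).trans ?_
      rw [abs_mul, abs_mul, abs_mul, abs_mul, abs_of_pos (by norm_num : (0 : ℝ) < 2)]
      gcongr
      refine (abs_sub _ _).trans ?_
      rw [abs_mul]
      gcongr
    refine this.trans ?_
    rw [← sq_abs (P x - k * π), ← sq_abs (p x)]
    nlinarith [sq_nonneg (|P x - k * π| - |p x|), sq_nonneg (|p x|), sq_nonneg (|P x - k * π|)]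
  have G0 : G x0 = 0 := by rw [hG]; simp [h0, hk]
  have Gn : ∀ x, 0 ≤ G x := fun x => by rw [hG]; positivity
  have Gz : ∀ x, G x = 0 := by
    intro x
    rcases le_total x0 x with hx | hx
    · have dE : ∀ x, HasDerivAt (fun x => G x * Real.exp (-(8 * x)))
        ((G' x - 8 * G x) * Real.exp (-(8 * x))) x := fun x => by
        have := ((hasDerivAt_id x).const_mul 8).fun_neg.exp
        refine ((dG x).mul this).congr_deriv ?_
        simp only [id]; ring
      have := anti_of convex_univ dE (fun x _ => by
        have := (abs_le.1 (bd x)).2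
        exact mul_nonpos_of_nonpos_of_nonneg (by linarith) (Real.exp_pos _).le)
        (Set.mem_univ x0) (Set.mem_univ x) hx
      simp only [G0, zero_mul] at this
      have h3 := Real.exp_pos (-(8 * x))
      have : G x ≤ 0 := by by_contra! hc; nlinarith [mul_pos hc h3]
      exact le_antisymm this (Gn x)
    · have dE : ∀ x, HasDerivAt (fun x => G x * Real.exp (8 * x))
        ((G' x + 8 * G x) * Real.exp (8 * x)) x := fun x => by
        have := ((hasDerivAt_id x).const_mul 8).exp
        refine ((dG x).mul this).congr_deriv ?_
        simp only [id]; ring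
      have := mono_of convex_univ dE (fun x _ => by
        have := (abs_le.1 (bd x)).1
        exact mul_nonneg (by linarith) (Real.exp_pos _).le)
        (Set.mem_univ x) (Set.mem_univ x0) hx
      simp only [G0, zero_mul] at this
      have h3 := Real.exp_pos (8 * x)
      have : G x ≤ 0 := by by_contra! hc; nlinarith [mul_pos hc h3]
      exact le_antisymm this (Gn x)
  have Pc : ∀ x, P x = k * π := fun x => by
    have := Gz x
    rw [hG] at this
    simp only at this
    have h5 : (P x - k * π) ^ 2 = 0 := by nlinarith [sq_nonneg (P x - k * π), sq_nonneg (p x)]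
    have := pow_eq_zero_iff two_ne_zero |>.1 h5
    linarith
  have hl := h.lb
  rw [show P = fun _ => k * π from funext Pc] at hl
  have := tendsto_nhds_unique hl tendsto_const_nhds
  intro x; rw [Pc x, ← this]

lemma dichotomy (h : Pend n P p) : (∀ x, P x = 0) ∨ ((∀ x, 0 < p x) ∧ ∀ x, 0 < P x ∧ P x < n * π) := by
  by_cases hz : ∃ x0, p x0 = 0
  · obtain ⟨x0, hx0⟩ := hz
    exact Or.inl (h.const_of_zero hx0)
  · push Not at hz
    right
    have cp : Continuous p := continuous_iff_continuousAt.2 fun x => (h.d1 x).continuousAt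
    have cases : (∀ x, 0 < p x) ∨ (∀ x, p x < 0) := by
      by_contra! hc
      obtain ⟨⟨a, ha⟩, ⟨b, hb⟩⟩ := hc
      obtain ⟨x, hx⟩ := mem_range_of_exists_le_of_exists_ge cp ⟨a, ha⟩ ⟨b, hb⟩
      exact hz x hx
    rcases cases with hp | hp
    · refine ⟨hp, ?_⟩
      have sm : StrictMono P := strictMono_of_hasDerivAt_pos h.d0 hp
      refine fun x => ⟨?_, ?_⟩
      · exact lt_of_le_of_lt (sm.monotone.le_of_tendsto h.lb (x - 1)) (sm (by linarith : x - 1 < x))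
      · refine lt_of_lt_of_le (sm (by linarith : x < x + 1)) (sm.monotone.ge_of_tendsto h.lt _)
    · exfalso
      have sm : StrictAnti P := strictAnti_of_hasDerivAt_neg h.d0 hp
      have h1 := sm.antitone.le_of_tendsto h.lt 1
      have h2 := sm.antitone.ge_of_tendsto h.lb 0
      have h3 := sm (by norm_num : (0 : ℝ) < 1)
      have : (0 : ℝ) ≤ n * π := by positivity
      linarith

end Pend

end


section

namespace Pend
variable {n : ℕ} {P p : ℝ → ℝ}

lemma sin_decay (h : Pend n P p) : ∃ C x0 : ℝ, 0 ≤ C ∧ 0 ≤ x0 ∧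
    ∀ x, x0 ≤ x → |Real.sin (P x)| ≤ C * Real.exp (-x) := by
  rcases h.dichotomy with hz | ⟨hp, hP⟩
  · exact ⟨0, 0, le_rfl, le_rfl, fun x _ => by simp [hz x]⟩
  have hpi := Real.pi_pos
  have ev := (h.lt.eventually (lt_mem_nhds (by linarith : (n : ℝ) * π - π / 4 < n * π))).and
    (eventually_ge_atTop 0)
  obtain ⟨x0, hx0⟩ := eventually_atTop.1 ev
  have dS : ∀ x, HasDerivAt (fun x => Real.sin (P x) ^ 2 * Real.exp (2 * x))
      ((Real.sin (2 * P x) * p x + 2 * Real.sin (P x) ^ 2) * Real.exp (2 * x)) x := fun x => by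
    have h1 := ((hasDerivAt_id x).const_mul 2).exp
    refine (((h.d0 x).sin.pow 2).mul h1).congr_deriv ?_
    rw [Real.sin_two_mul]; simp only [id]; push_cast
    simp only [Pi.pow_apply]
    ring
  have anti := anti_of (convex_Ici x0) dS (fun x hx => by
    rw [interior_Ici] at hx
    have h1 := (hx0 x (le_of_lt hx)).1
    have h2 := (hP x).2
    apply mul_nonpos_of_nonpos_of_nonneg _ (Real.exp_pos _).le
    set y := n * π - P x with hy
    have ePx : P x = n * π - y := by rw [hy]; ring
    have hs2 : Real.sin (P x) ^ 2 = Real.sin y ^ 2 := by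
      rw [ePx, Real.sin_nat_mul_pi_sub, neg_sq, mul_pow, ← pow_mul, mul_comm n 2, pow_mul]
      simp
    have hs2' : Real.sin (2 * P x) = - Real.sin (2 * y) := by
      rw [ePx, show 2 * (n * π - y) = -(2 * y) + n * (2 * π) by ring,
        Real.sin_add_nat_mul_two_pi, Real.sin_neg]
    have y0 : 0 < y := by linarith
    have y1 : y < π / 4 := by linarith
    have sy : 0 < Real.sin y := Real.sin_pos_of_pos_of_lt_pi y0 (by linarith)
    have cy : √2 / 2 ≤ Real.cos y := by
      rw [← Real.cos_pi_div_four]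
      exact Real.cos_le_cos_of_nonneg_of_le_pi y0.le (by linarith) y1.le
    have cy0 : 0 ≤ Real.cos y := le_trans (by positivity) cy
    have hW := h.W_nonneg x
    rw [hs2] at hW
    have s2 : √2 * √2 = 2 := Real.mul_self_sqrt (by norm_num)
    have s2p : 0 < √2 := by positivity
    have hpx : √2 * Real.sin y ≤ p x := by
      apply abs_le_of_sq_le_sq' _ (hp x).le |>.2
      nlinarith
    rw [hs2, hs2', Real.sin_two_mul]
    have h3 : 2 * Real.sin y * (√2 / 2) * (√2 * Real.sin y) ≤ 2 * Real.sin y * Real.cos y * p x := by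
      gcongr
    have h4 : 2 * Real.sin y * (√2 / 2) * (√2 * Real.sin y) = 2 * Real.sin y ^ 2 := by
      linear_combination Real.sin y ^ 2 * s2
    linarith)
  set K := Real.sin (P x0) ^ 2 * Real.exp (2 * x0) with hK
  refine ⟨√K, x0, Real.sqrt_nonneg _, (hx0 x0 le_rfl).2, fun x hx => ?_⟩
  have h1 := anti (Set.self_mem_Ici) hx hx
  simp only at h1
  apply abs_le_of_sq_le_sq _ (by positivity)
  have hK0 : 0 ≤ K := by positivity
  rw [mul_pow, Real.sq_sqrt hK0]
  have e : Real.exp (-x) ^ 2 = (Real.exp (2 * x))⁻¹ := by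
    rw [← Real.exp_neg, sq, ← Real.exp_add]; ring_nf
  rw [e, ← div_eq_mul_inv, le_div_iff₀ (Real.exp_pos _)]
  exact h1

end Pend

/-- continuation argument -/
lemma forward_pos {d d' G G' : ℝ → ℝ} (hd : ∀ x, HasDerivAt d (d' x) x)
    (hG : ∀ x, HasDerivAt G (G' x) x) (h1 : ∀ x, 0 < d x → 0 < G' x)
    (h2 : ∀ x, 0 ≤ G x → 0 ≤ d' x) {x0 : ℝ} (hd0 : 0 < d x0) (hG0 : 0 ≤ G x0) :
    ∀ x, x0 ≤ x → 0 < d x := by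
  by_contra! hc
  obtain ⟨y, hy, hy2⟩ := hc
  have cd : Continuous d := continuous_iff_continuousAt.2 fun x => (hd x).continuousAt
  set S := {x | x0 ≤ x ∧ d x ≤ 0} with hS
  have Sc : IsClosed S := (isClosed_Ici).inter (isClosed_le cd continuous_const)
  have Sb : BddBelow S := ⟨x0, fun x hx => hx.1⟩
  have hb := Sc.csInf_mem ⟨y, hy, hy2⟩ Sb
  set b := sInf S
  have lt : ∀ x ∈ Set.Ico x0 b, 0 < d x := fun x hx => by
    by_contra! hcc
    exact absurd (csInf_le Sb (show x ∈ S from ⟨hx.1, hcc⟩)) (not_le.2 hx.2)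
  have mG : MonotoneOn G (Set.Icc x0 b) := mono_of (convex_Icc _ _) hG fun x hx => by
    rw [interior_Icc] at hx
    exact (h1 x (lt x ⟨hx.1.le, hx.2⟩)).le
  have md : MonotoneOn d (Set.Icc x0 b) := mono_of (convex_Icc _ _) hd fun x hx => by
    rw [interior_Icc] at hx
    exact h2 x (hG0.trans (mG ⟨le_rfl, hb.1⟩ ⟨hx.1.le, hx.2.le⟩ hx.1.le))
  have := md ⟨le_rfl, hb.1⟩ ⟨hb.1, le_rfl⟩ hb.1
  linarith [hb.2]

lemma no_pos {d d' G G' : ℝ → ℝ} (hd : ∀ x, HasDerivAt d (d' x) x)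
    (hG : ∀ x, HasDerivAt G (G' x) x) (h1 : ∀ x, 0 < d x → 0 < G' x)
    (h2 : ∀ x, 0 ≤ G x → 0 ≤ d' x) (hlim : Tendsto G atTop (nhds 0))
    {x0 : ℝ} (hd0 : 0 < d x0) : G x0 < 0 := by
  by_contra! hG0
  have hp := forward_pos hd hG h1 h2 hd0 hG0
  have sm : StrictMonoOn G (Set.Ici x0) := by
    refine strictMonoOn_of_deriv_pos (convex_Ici _)
      (fun x _ => (hG x).continuousAt.continuousWithinAt) fun x hx => ?_
    rw [interior_Ici] at hx
    rw [(hG x).deriv]; exact h1 x (hp x hx.le)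
  have h3 : G x0 < G (x0 + 1) := sm Set.self_mem_Ici (by simp : x0 + 1 ∈ Set.Ici x0) (by linarith)
  have h4 : G (x0 + 1) ≤ 0 := ge_of_tendsto hlim ((eventually_ge_atTop (x0 + 1)).mono fun x hx =>
    sm.monotoneOn (by simp : x0 + 1 ∈ Set.Ici x0) (show x0 ≤ x by linarith) hx)
  linarith

lemma never_pos {d d' G G' : ℝ → ℝ} (hd : ∀ x, HasDerivAt d (d' x) x)
    (hG : ∀ x, HasDerivAt G (G' x) x) (h1 : ∀ x, 0 < d x → 0 < G' x)
    (h2 : ∀ x, 0 ≤ G x → 0 ≤ d' x) (h3 : ∀ x, G x ≤ 0 → d' x ≤ 0)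
    (hlim : Tendsto G atTop (nhds 0)) (hlim' : Tendsto G atBot (nhds 0)) (x0 : ℝ) : d x0 ≤ 0 := by
  by_contra! hd0
  have a := no_pos hd hG h1 h2 hlim hd0
  have b := no_pos (d := fun x => d (-x)) (G := fun x => - G (-x)) (d' := fun x => - d' (-x))
    (G' := fun x => G' (-x)) (x0 := -x0)
    (fun x => by
      have := (hd (-x)).comp x (hasDerivAt_neg x)
      exact this.congr_deriv (by ring))
    (fun x => by
      have := ((hG (-x)).comp x (hasDerivAt_neg x)).neg
      exact this.congr_deriv (by ring))
    (fun x hx => h1 (-x) hx) (fun x hx => by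
      have := h3 (-x) (by linarith)
      linarith)
    (by simpa using (hlim'.comp tendsto_neg_atTop_atBot).neg) (by simpa using hd0)
  simp only [neg_neg] at b
  linarith

lemma Pend.le_of {n : ℕ} {P1 p1 P2 p2 : ℝ → ℝ} (h1 : Pend n P1 p1) (h2 : Pend n P2 p2)
    (hp1 : ∀ x, 0 < p1 x) (hp2 : ∀ x, 0 < p2 x) (hP1 : ∀ x, 0 < P1 x ∧ P1 x < n * π)
    (hP2 : ∀ x, 0 < P2 x ∧ P2 x < n * π) (x : ℝ) : P2 x ≤ P1 x := by
  have c1 : Continuous P1 := continuous_iff_continuousAt.2 fun x => (h1.d0 x).continuousAt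
  have c2 : Continuous P2 := continuous_iff_continuousAt.2 fun x => (h2.d0 x).continuousAt
  have cp2 : Continuous p2 := continuous_iff_continuousAt.2 fun x => (h2.d1 x).continuousAt
  have sm1 : StrictMono P1 := strictMono_of_hasDerivAt_pos h1.d0 hp1
  have sm2 : StrictMono P2 := strictMono_of_hasDerivAt_pos h2.d0 hp2
  have sur : ∀ {P p : ℝ → ℝ}, Pend n P p → Continuous P → ∀ y, 0 < y → y < n * π → ∃ x, P x = y := by
    intro P p h c y hy0 hy1
    have e1 := (h.lb.eventually (gt_mem_nhds hy0)).exists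
    have e2 := (h.lt.eventually (lt_mem_nhds hy1)).exists
    obtain ⟨a, ha⟩ := e1
    obtain ⟨b, hb⟩ := e2
    exact mem_range_of_exists_le_of_exists_ge c ⟨a, ha.le⟩ ⟨b, hb.le⟩
  choose σ hσ using fun x => sur h2 c2 (P1 x) (hP1 x).1 (hP1 x).2
  have smσ : StrictMono σ := fun a b hab => by
    rw [← sm2.lt_iff_lt, hσ, hσ]; exact sm1 hab
  have surσ : Function.Surjective σ := fun y => by
    obtain ⟨x, hx⟩ := sur h1 c1 (P2 y) (hP2 y).1 (hP2 y).2
    exact ⟨x, sm2.injective (by rw [hσ, hx])⟩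
  have cσ : Continuous σ := smσ.monotone.continuous_of_surjective surσ
  have dσ : ∀ x, HasDerivAt σ (p1 x / p2 (σ x)) x := fun x => by
    rw [hasDerivAt_iff_tendsto_slope]
    have s1 := hasDerivAt_iff_tendsto_slope.1 (h1.d0 x)
    have s2 := hasDerivAt_iff_tendsto_slope.1 (h2.d0 (σ x))
    have tσ : Tendsto σ (nhdsWithin x {x}ᶜ) (nhdsWithin (σ x) {σ x}ᶜ) :=
      tendsto_nhdsWithin_iff.2 ⟨(cσ.tendsto x).mono_left nhdsWithin_le_nhds,
        eventually_mem_nhdsWithin.mono fun y hy => smσ.injective.ne hy⟩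
    refine (s1.div (s2.comp tσ) (hp2 _).ne').congr' ?_
    refine eventually_mem_nhdsWithin.mono fun y hy => ?_
    have hy1 : y - x ≠ 0 := sub_ne_zero.2 hy
    have hy2 : σ y - σ x ≠ 0 := sub_ne_zero.2 (smσ.injective.ne hy)
    have hy3 : P1 y - P1 x ≠ 0 := sub_ne_zero.2 (sm1.injective.ne hy)
    simp only [Function.comp, Pi.div_apply, slope_def_field, hσ]
    field_simp
  -- the integrating factor
  set g : ℝ → ℝ := fun x => Real.sin (2 * P1 x) / p2 (σ x) with hg
  have cg : Continuous g := Continuous.div (by fun_prop) (cp2.comp cσ) fun x => (hp2 _).ne'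
  set M : ℝ → ℝ := fun x => ∫ s in (0 : ℝ)..x, g s with hM
  have dM : ∀ x, HasDerivAt M (g x) x := fun x =>
    intervalIntegral.integral_hasDerivAt_right (cg.intervalIntegrable _ _)
      (cg.stronglyMeasurableAtFilter _ _) cg.continuousAt
  set Ee : ℝ → ℝ := fun x => p2 (σ x) - p1 x with hEe
  have dE : ∀ x, HasDerivAt Ee ((th x - th (σ x)) * p1 x - g x * Ee x) x := fun x => by
    refine (((h2.d1 (σ x)).comp x (dσ x)).sub (h1.d1 x)).congr_deriv ?_
    rw [hg, hEe, hσ]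
    have := (hp2 (σ x)).ne'
    simp only
    field_simp
    ring
  have dG : ∀ x, HasDerivAt (fun x => Real.exp (M x) * Ee x)
      (Real.exp (M x) * ((th x - th (σ x)) * p1 x)) x := fun x => by
    refine ((dM x).exp.mul (dE x)).congr_deriv ?_
    ring
  have dd : ∀ x, HasDerivAt (fun x => x - σ x) (Ee x / p2 (σ x)) x := fun x => by
    refine ((hasDerivAt_id x).sub (dσ x)).congr_deriv ?_
    rw [hEe]
    have := (hp2 (σ x)).ne'
    field_simp
  have hpi := Real.pi_pos
  -- limits
  have limE_top : Tendsto Ee atTop (nhds 0) := by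
    have := (h2.p_top.comp (smσ.monotone.tendsto_atTop_atTop fun b => by
      obtain ⟨a, ha⟩ := surσ b; exact ⟨a, ha.ge⟩)).sub h1.p_top
    simpa using this
  have limE_bot : Tendsto Ee atBot (nhds 0) := by
    have := (h2.p_bot.comp (smσ.monotone.tendsto_atBot_atBot fun b => by
      obtain ⟨a, ha⟩ := surσ b; exact ⟨a, ha.le⟩)).sub h1.p_bot
    simpa using this
  have sq : ∀ {l : Filter ℝ} {K : ℝ}, Tendsto Ee l (nhds 0) → (∀ᶠ x in l, M x ≤ K) →
      Tendsto (fun x => Real.exp (M x) * Ee x) l (nhds 0) := by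
    intro l K hl hK
    have hl2 : Tendsto (fun x => Real.exp K * |Ee x|) l (nhds 0) := by
      simpa using hl.abs.const_mul (Real.exp K)
    refine squeeze_zero_norm' (hK.mono fun x hx => ?_) hl2
    rw [Real.norm_eq_abs, abs_mul, abs_of_pos (Real.exp_pos _)]
    gcongr
  have lim_top : Tendsto (fun x => Real.exp (M x) * Ee x) atTop (nhds 0) := by
    obtain ⟨X, hX⟩ := eventually_atTop.1
      (h1.lt.eventually (lt_mem_nhds (by linarith : (n : ℝ) * π - π / 2 < n * π)))
    have an := anti_of (convex_Ici X) dM (fun x hx => by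
      rw [interior_Ici] at hx
      have a1 := hX x (le_of_lt hx)
      have a2 := (hP1 x).2
      rw [hg]
      refine div_nonpos_of_nonpos_of_nonneg ?_ (hp2 _).le
      rw [show 2 * P1 x = -(2 * (n * π - P1 x)) + n * (2 * π) by ring,
        Real.sin_add_nat_mul_two_pi, Real.sin_neg]
      have := Real.sin_nonneg_of_nonneg_of_le_pi (x := 2 * (n * π - P1 x)) (by linarith)
        (by linarith)
      linarith)
    exact sq limE_top (eventually_ge_atTop X |>.mono fun x hx => an Set.self_mem_Ici hx hx)
  have lim_bot : Tendsto (fun x => Real.exp (M x) * Ee x) atBot (nhds 0) := by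
    obtain ⟨X, hX⟩ := eventually_atBot.1
      (h1.lb.eventually (gt_mem_nhds (by linarith : 0 < π / 2)))
    have an := mono_of (convex_Iic X) dM (fun x hx => by
      rw [interior_Iic] at hx
      have a1 := hX x (le_of_lt hx)
      have a2 := (hP1 x).1
      rw [hg]
      refine div_nonneg ?_ (hp2 _).le
      exact Real.sin_nonneg_of_nonneg_of_le_pi (by linarith) (by linarith))
    exact sq limE_bot (eventually_le_atBot X |>.mono fun x hx => an hx Set.self_mem_Iic hx)
  have fin := never_pos dd dG (fun x hx => by
      have := th_lt (by linarith : σ x < x)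
      have h3 := hp1 x
      have := Real.exp_pos (M x)
      have : 0 < th x - th (σ x) := by linarith
      positivity)
    (fun x hx => by
      have : 0 ≤ Ee x := by
        by_contra! hc
        have := mul_neg_of_pos_of_neg (Real.exp_pos (M x)) hc
        linarith
      exact div_nonneg this (hp2 _).le)
    (fun x hx => by
      have : Ee x ≤ 0 := by
        by_contra! hc
        have := mul_pos (Real.exp_pos (M x)) hc
        linarith
      exact div_nonpos_of_nonpos_of_nonneg this (hp2 _).le)
    lim_top lim_bot x
  rw [← hσ x]
  exact sm2.monotone (by linarith)

lemma Pend.unique {n : ℕ} {P1 p1 P2 p2 : ℝ → ℝ} (h1 : Pend n P1 p1) (h2 : Pend n P2 p2) :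
    ∀ x, P1 x = P2 x := by
  have nz : ∀ {P p : ℝ → ℝ}, Pend n P p → (∀ x, P x = 0) → n = 0 := fun {P p} h hz => by
    have := h.lt
    rw [show P = fun _ => 0 from funext hz] at this
    have h3 := tendsto_nhds_unique this tendsto_const_nhds
    have : (n : ℝ) = 0 := by
      rcases mul_eq_zero.1 h3 with h | h
      · exact h
      · exact absurd h Real.pi_ne_zero
    exact_mod_cast this
  rcases h1.dichotomy with hz1 | ⟨hp1, hP1⟩
  · have n0 := nz h1 hz1
    rcases h2.dichotomy with hz2 | ⟨hp2, hP2⟩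
    · intro x; rw [hz1, hz2]
    · have := hP2 0; rw [n0] at this; simp at this; linarith
  · rcases h2.dichotomy with hz2 | ⟨hp2, hP2⟩
    · have n0 := nz h2 hz2
      have := hP1 0; rw [n0] at this; simp at this; linarith
    · intro x
      exact le_antisymm (h2.le_of h1 hp2 hp1 hP2 hP1 x) (h1.le_of h2 hp1 hp2 hP1 hP2 x)

/-- passing to the pendulum variable -/
lemma pend_of_ode {n : ℕ} {Q q q' : ℝ → ℝ} (d0 : ∀ r, HasDerivAt Q (q r) r)
    (d1 : ∀ r, HasDerivAt q (q' r) r)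
    (ode : ∀ r, q' r + (2 * r / (r ^ 2 + 1)) * q r - Real.sin (2 * Q r) / (r ^ 2 + 1) = 0)
    (lb : Tendsto Q atBot (nhds 0)) (lt : Tendsto Q atTop (nhds ((n : ℝ) * π))) :
    Pend n (fun x => Q (Real.sinh x)) (fun x => q (Real.sinh x) * Real.cosh x) := by
  have st : Tendsto Real.sinh atTop atTop := Real.sinhOrderIso.tendsto_atTop
  have sb : Tendsto Real.sinh atBot atBot := Real.sinhOrderIso.tendsto_atBot
  refine ⟨fun x => (d0 _).comp x (Real.hasDerivAt_sinh x), fun x => ?_, lb.comp sb, lt.comp st⟩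
  refine (((d1 _).comp x (Real.hasDerivAt_sinh x)).mul (Real.hasDerivAt_cosh x)).congr_deriv ?_
  have o := ode (Real.sinh x)
  rw [show Real.sinh x ^ 2 + 1 = Real.cosh x ^ 2 by rw [Real.cosh_sq]] at o
  have hc := (Real.cosh_pos x).ne'
  unfold th
  field_simp at o ⊢
  simp only [Function.comp]
  linear_combination o

lemma sinQ_decay {n : ℕ} {Q q q' : ℝ → ℝ} (d0 : ∀ r, HasDerivAt Q (q r) r)
    (d1 : ∀ r, HasDerivAt q (q' r) r)
    (ode : ∀ r, q' r + (2 * r / (r ^ 2 + 1)) * q r - Real.sin (2 * Q r) / (r ^ 2 + 1) = 0)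
    (lb : Tendsto Q atBot (nhds 0)) (lt : Tendsto Q atTop (nhds ((n : ℝ) * π))) :
    ∃ C, 0 ≤ C ∧ ∀ r, 1 ≤ r → |Real.sin (Q r)| ≤ C / r := by
  obtain ⟨C, x0, hC, hx0, h⟩ := (pend_of_ode d0 d1 ode lb lt).sin_decay
  refine ⟨C + Real.sinh x0, add_nonneg hC (Real.sinh_nonneg_iff.2 hx0), fun r hr => ?_⟩
  have hr0 : 0 < r := by linarith
  rw [le_div_iff₀ hr0]
  have hs0 := Real.sinh_nonneg_iff.2 hx0
  rcases le_total x0 (Real.arsinh r) with hx | hx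
  · have h1 := h _ hx
    simp only [Real.sinh_arsinh] at h1
    have h2 : r ≤ Real.exp (Real.arsinh r) := by
      have e := Real.sinh_eq (Real.arsinh r)
      rw [Real.sinh_arsinh] at e
      have := Real.exp_pos (Real.arsinh r)
      have := Real.exp_pos (-Real.arsinh r)
      linarith
    have h3 : Real.exp (-Real.arsinh r) * r ≤ 1 := by
      calc _ ≤ Real.exp (-Real.arsinh r) * Real.exp (Real.arsinh r) := by gcongr
        _ = 1 := by rw [← Real.exp_add]; simp
    calc |Real.sin (Q r)| * r ≤ C * Real.exp (-Real.arsinh r) * r := by gcongr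
      _ = C * (Real.exp (-Real.arsinh r) * r) := by ring
      _ ≤ C * 1 := by gcongr
      _ ≤ _ := by linarith
  · have h1 := Real.abs_sin_le_one (Q r)
    have h2 : r ≤ Real.sinh x0 := by
      rw [← Real.sinh_arsinh r]; exact Real.sinh_le_sinh.2 hx
    nlinarith

end


section

/-! ## The nonlinearity -/

noncomputable def jb (r : ℝ) : ℝ := √(r ^ 2 + 1)

lemma jb_sq (r : ℝ) : jb r ^ 2 = r ^ 2 + 1 := Real.sq_sqrt (by positivity)
lemma jb_ge_one (r : ℝ) : 1 ≤ jb r := by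
  have := jb_sq r
  have h0 : 0 ≤ jb r := Real.sqrt_nonneg _
  nlinarith [sq_nonneg r]
lemma jb_pos (r : ℝ) : 0 < jb r := lt_of_lt_of_le one_pos (jb_ge_one r)
lemma jb_ge {r : ℝ} (hr : 0 ≤ r) : r ≤ jb r := by
  have := jb_sq r
  have h0 : 0 ≤ jb r := Real.sqrt_nonneg _
  nlinarith [sq_nonneg r]

noncomputable def Gn (Q : ℝ → ℝ) (r w : ℝ) : ℝ :=
  w / (r ^ 2 + 1) ^ 2 + (Real.sin (2 * Q r + 2 * (w / jb r)) - Real.sin (2 * Q r)) / jb r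

noncomputable def Fn (Q : ℝ → ℝ) (r w : ℝ) : ℝ := 2 * w / r ^ 2 - Gn Q r w

lemma Gn_zero (Q : ℝ → ℝ) (r : ℝ) : Gn Q r 0 = 0 := by simp [Gn]
lemma Fn_zero (Q : ℝ → ℝ) (r : ℝ) : Fn Q r 0 = 0 := by simp [Fn, Gn]

lemma Gn_deriv (Q : ℝ → ℝ) (r w : ℝ) : HasDerivAt (Gn Q r)
    (1 / (r ^ 2 + 1) ^ 2 + 2 * Real.cos (2 * Q r + 2 * (w / jb r)) / (r ^ 2 + 1)) w := by
  unfold Gn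
  have hj := jb_pos r
  have h1 : HasDerivAt (fun w => 2 * Q r + 2 * (w / jb r)) (2 * (1 / jb r)) w :=
    (((hasDerivAt_id w).div_const _).const_mul 2).const_add _
  refine (((hasDerivAt_id w).div_const _).add ((h1.sin.sub_const _).div_const _)).congr_deriv ?_
  rw [← jb_sq]; field_simp

lemma Gn_le {Q : ℝ → ℝ} {r w : ℝ} (hr : 1 ≤ r) : |Gn Q r w| ≤ 2 / r + |w| / r ^ 4 := by
  unfold Gn
  have hr0 : 0 < r := by linarith
  have h1 : |w / (r ^ 2 + 1) ^ 2| ≤ |w| / r ^ 4 := by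
    rw [abs_div, abs_of_pos (by positivity : 0 < (r ^ 2 + 1) ^ 2)]
    gcongr
    nlinarith [sq_nonneg r]
  have h2 : |(Real.sin (2 * Q r + 2 * (w / jb r)) - Real.sin (2 * Q r)) / jb r| ≤ 2 / r := by
    rw [abs_div, abs_of_pos (jb_pos r)]
    have := jb_ge hr0.le
    have h3 : |Real.sin (2 * Q r + 2 * (w / jb r)) - Real.sin (2 * Q r)| ≤ 2 := by
      have a1 := Real.sin_le_one (2 * Q r + 2 * (w / jb r))
      have a2 := Real.neg_one_le_sin (2 * Q r + 2 * (w / jb r))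
      have a3 := Real.sin_le_one (2 * Q r)
      have a4 := Real.neg_one_le_sin (2 * Q r)
      rw [abs_le]; constructor <;> linarith
    gcongr
  refine (abs_add_le _ _).trans ?_
  linarith

lemma Gn_lip (Q : ℝ → ℝ) (r w1 w2 : ℝ) : |Gn Q r w1 - Gn Q r w2| ≤ 3 * |w1 - w2| := by
  have := (convex_univ (𝕜 := ℝ) (E := ℝ)).norm_image_sub_le_of_norm_hasDerivWithin_le
    (f := Gn Q r) (C := 3) (x := w2) (y := w1)
    (fun x _ => (Gn_deriv Q r x).hasDerivWithinAt) (fun x _ => ?_) (Set.mem_univ _) (Set.mem_univ _)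
  · simpa using this
  · rw [Real.norm_eq_abs]
    set c := Real.cos (2 * Q r + 2 * (x / jb r)) with hc
    have h1 : 1 / (r ^ 2 + 1) ^ 2 ≤ 1 := by
      rw [div_le_one (by positivity)]; nlinarith [sq_nonneg r]
    have h2 : |2 * c / (r ^ 2 + 1)| ≤ 2 := by
      rw [abs_div, abs_of_pos (by positivity : 0 < r ^ 2 + 1), div_le_iff₀ (by positivity), abs_mul]
      have := Real.abs_cos_le_one (2 * Q r + 2 * (x / jb r))
      rw [← hc] at this
      norm_num
      nlinarith [sq_nonneg r]
    have h3 : |1 / (r ^ 2 + 1) ^ 2| ≤ 1 := by rwa [abs_of_pos (by positivity)]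
    refine (abs_add_le _ _).trans ?_
    linarith

lemma Fn_lip {Q : ℝ → ℝ} {C W r w1 w2 : ℝ} (hC : 0 ≤ C) (hr : 1 ≤ r)
    (hQ : |Real.sin (Q r)| ≤ C / r)
    (h1 : |w1| ≤ W) (h2 : |w2| ≤ W) :
    |Fn Q r w1 - Fn Q r w2| ≤ (3 + 4 * (C + W) ^ 2) / r ^ 4 * |w1 - w2| := by
  have hr0 : 0 < r := by linarith
  have hW : 0 ≤ W := (abs_nonneg _).trans h1
  have := (convex_Icc (-W) W).norm_image_sub_le_of_norm_hasDerivWithin_le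
    (f := Fn Q r) (C := (3 + 4 * (C + W) ^ 2) / r ^ 4) (x := w2) (y := w1)
    (f' := fun w => 2 / r ^ 2 - (1 / (r ^ 2 + 1) ^ 2 + 2 * Real.cos (2 * Q r + 2 * (w / jb r)) / (r ^ 2 + 1)))
    (fun x _ => ?_) (fun x hx => ?_) (abs_le.1 h2) (abs_le.1 h1)
  · simpa using this
  · unfold Fn
    refine HasDerivAt.hasDerivWithinAt ((((hasDerivAt_id x).const_mul 2).div_const _).sub (Gn_deriv Q r x) |>.congr_deriv ?_)
    simp
  · rw [Real.norm_eq_abs]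
    have hj := jb_pos r
    have hjr := jb_ge hr0.le
    have hs : |Real.sin (Q r + x / jb r)| ≤ (C + W) / r := by
      have e1 : |Real.sin (x / jb r)| ≤ W / r := by
        refine (Real.abs_sin_le_abs).trans ?_
        rw [abs_div, abs_of_pos hj]
        have := abs_le.2 hx
        gcongr
      rw [Real.sin_add, add_div]
      have c1 := Real.abs_cos_le_one (Q r)
      have c2 := Real.abs_cos_le_one (x / jb r)
      refine (abs_add_le _ _).trans ?_
      rw [abs_mul, abs_mul]
      have := abs_nonneg (Real.sin (Q r))
      have := abs_nonneg (Real.sin (x / jb r))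
      nlinarith
    have hcos : Real.cos (2 * Q r + 2 * (x / jb r)) = 1 - 2 * Real.sin (Q r + x / jb r) ^ 2 := by
      rw [← mul_add, Real.cos_two_mul, Real.cos_sq']; ring
    rw [hcos]
    set s := Real.sin (Q r + x / jb r)
    have hs2 : s ^ 2 ≤ (C + W) ^ 2 / r ^ 2 := by
      rw [← div_pow, ← sq_abs]
      gcongr
    have e : 2 / r ^ 2 - (1 / (r ^ 2 + 1) ^ 2 + 2 * (1 - 2 * s ^ 2) / (r ^ 2 + 1))
      = 2 / (r ^ 2 * (r ^ 2 + 1)) - 1 / (r ^ 2 + 1) ^ 2 + 4 * s ^ 2 / (r ^ 2 + 1) := by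
      field_simp; ring
    have b1 : 2 / (r ^ 2 * (r ^ 2 + 1)) ≤ 2 / r ^ 4 := by
      gcongr; nlinarith [sq_nonneg r]
    have b2 : 1 / (r ^ 2 + 1) ^ 2 ≤ 1 / r ^ 4 := by
      gcongr; nlinarith [sq_nonneg r]
    have b3 : 4 * s ^ 2 / (r ^ 2 + 1) ≤ 4 * (C + W) ^ 2 / r ^ 4 := by
      calc 4 * s ^ 2 / (r ^ 2 + 1) ≤ 4 * ((C + W) ^ 2 / r ^ 2) / r ^ 2 := by
            gcongr; linarith
        _ = _ := by field_simp
    have p1 : 0 ≤ 2 / (r ^ 2 * (r ^ 2 + 1)) := by positivity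
    have p2 : 0 ≤ 1 / (r ^ 2 + 1) ^ 2 := by positivity
    have p3 : 0 ≤ 4 * s ^ 2 / (r ^ 2 + 1) := by positivity
    have p4 : 0 ≤ 1 / r ^ 4 := by positivity
    have p5 : 2 / r ^ 4 = 2 * (1 / r ^ 4) := by ring
    have p6 : (3 + 4 * (C + W) ^ 2) / r ^ 4 = 3 * (1 / r ^ 4) + 4 * (C + W) ^ 2 / r ^ 4 := by ring
    rw [e, abs_le]
    constructor <;> linarith

end


section

section
variable {w wt wr wtt wtr wrr : ℝ → ℝ → ℝ}

lemma rw_growth {f f' : ℝ → ℝ} {B : ℝ} (hf : ∀ r, HasDerivAt f (f' r) r)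
    (h : ∀ r, 1 ≤ r → |f' r + f r / r| ≤ B / r) {r : ℝ} (hr : 1 ≤ r) :
    |r * f r - f 1| ≤ B * (r - 1) := by
  have := abs_sub_le_of_deriv (X := fun s => s * f s) (B := fun s => B * s) (B' := fun _ => B)
    (X' := fun s => 1 * f s + s * f' s) hr (fun s _ => (hasDerivAt_id s).mul (hf s))
    (fun s _ => by simpa using (hasDerivAt_id s).const_mul B)
    (fun s hs => by
      have hs0 : 0 < s := by linarith [hs.1]
      have h1 := h s hs.1
      have e : 1 * f s + s * f' s = s * (f' s + f s / s) := by field_simp; ring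
      rw [e, abs_mul, abs_of_pos hs0]
      rw [le_div_iff₀ hs0] at h1
      linarith)
  simp only [one_mul] at this
  linarith

lemma rw_cauchy {f f' : ℝ → ℝ} {B R0 : ℝ} (hf : ∀ r, HasDerivAt f (f' r) r) (hR0 : 1 ≤ R0)
    (h : ∀ r, R0 ≤ r → |f' r + f r / r| ≤ B / r ^ 3) {a b : ℝ} (ha : R0 ≤ a) (hab : a ≤ b) :
    |b * f b - a * f a| ≤ B / a := by
  have ha0 : 0 < a := by linarith
  have hB : 0 ≤ B := by
    have h1 := (abs_nonneg _).trans (h a ha)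
    by_contra hn
    have := div_neg_of_neg_of_pos (not_le.1 hn) (by positivity : 0 < a ^ 3)
    linarith
  have := abs_sub_le_of_deriv (X := fun s => s * f s)
    (B := fun s => B * (-(1 / (((0 : ℕ) + 1) * (0 + s) ^ (0 + 1)))))
    (B' := fun s => B * (1 / (0 + s) ^ (0 + 2)))
    (X' := fun s => 1 * f s + s * f' s) hab (fun s _ => (hasDerivAt_id s).mul (hf s))
    (fun s hs => (hasDerivAt_inv_pow 0 0 (by linarith [hs.1])).const_mul B)
    (fun s hs => by
      have hs0 : 0 < s := by linarith [hs.1]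
      have h1 := h s (by linarith [hs.1])
      have e : 1 * f s + s * f' s = s * (f' s + f s / s) := by field_simp; ring
      rw [e, abs_mul, abs_of_pos hs0]
      calc s * |f' s + f s / s| ≤ s * (B / s ^ 3) := by gcongr
        _ = _ := by simp only [zero_add]; field_simp)
  have hb0 : 0 < b := by linarith
  have h3 : 0 ≤ B / b := by positivity
  norm_num at this
  rw [div_eq_mul_inv]
  rw [div_eq_mul_inv] at h3
  linarith

lemma exists_lim {f : ℝ → ℝ} {B : ℝ}
    (h : ∀ a b, 1 ≤ a → a ≤ b → |b * f b - a * f a| ≤ B / a) :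
    ∃ l, Tendsto (fun r => r * f r) atTop (nhds l) ∧ ∀ r, 1 ≤ r → |r * f r - l| ≤ B / r := by
  have hB : 0 ≤ B := by
    have h1 := (abs_nonneg _).trans (h 1 1 le_rfl le_rfl)
    simpa using h1
  have hc : CauchySeq (fun r : ℝ => (max r 1) * f (max r 1)) := by
    refine cauchySeq_of_le_tendsto_0 (fun N => B / max N 1) ?_ ?_
    · intro n m N hn hm
      rw [Real.dist_eq]
      have key : ∀ n m, N ≤ n → n ≤ m →
          |max m 1 * f (max m 1) - max n 1 * f (max n 1)| ≤ B / max N 1 := by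
        intro n m hn hm
        refine (h _ _ (le_max_right _ _) (max_le_max_right 1 hm)).trans ?_
        have : 0 < max N 1 := lt_of_lt_of_le one_pos (le_max_right _ _)
        have := max_le_max_right 1 hn
        gcongr
      rcases le_total n m with h1 | h1
      · rw [abs_sub_comm]; exact key n m hn h1
      · exact key m n hm h1
    · refine Tendsto.div_atTop tendsto_const_nhds ?_
      exact tendsto_atTop_mono (fun x => le_max_left x 1) tendsto_id
  obtain ⟨l, hl⟩ := cauchySeq_tendsto_of_complete hc
  have hl' : Tendsto (fun r => r * f r) atTop (nhds l) := by
    refine hl.congr' ?_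
    filter_upwards [eventually_ge_atTop 1] with r hr
    rw [max_eq_left hr]
  refine ⟨l, hl', fun r hr => ?_⟩
  have h1 : Tendsto (fun b => |b * f b - r * f r|) atTop (nhds |l - r * f r|) :=
    (hl'.sub_const _).abs
  rw [abs_sub_comm]
  refine le_of_tendsto h1 ?_
  filter_upwards [eventually_ge_atTop r] with b hb
  exact h r b hr hb

lemma second_diff {g g' g'' : ℝ → ℝ} {M : ℝ} (h0 : ∀ t, HasDerivAt g (g' t) t)
    (h1 : ∀ t, HasDerivAt g' (g'' t) t) (h2 : ∀ t, |g'' t| ≤ M) (t : ℝ) {τ : ℝ} (hτ : 0 ≤ τ) :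
    |g (t + τ) + g (t - τ) - 2 * g t| ≤ M * τ ^ 2 := by
  have A : ∀ a b, a ≤ b → |g' b - g' a| ≤ M * b - M * a := fun a b hab =>
    abs_sub_le_of_deriv (X := g') (B := fun s => M * s) (B' := fun _ => M) hab
      (fun s _ => h1 s) (fun s _ => by simpa using (hasDerivAt_id s).const_mul M) (fun s _ => h2 s)
  have := abs_sub_le_of_deriv (X := fun s => g (t + s) + g (t - s)) (B := fun s => M * s ^ 2)
    (B' := fun s => M * (2 * s)) (X' := fun s => g' (t + s) - g' (t - s)) hτ
    (fun s _ => by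
      have e1 := (h0 (t + s)).comp_const_add t s
      have e2 := (h0 (t - s)).comp_const_sub t s
      exact (e1.add e2).congr_deriv (by ring))
    (fun s _ => by simpa using (hasDerivAt_pow 2 s).const_mul M)
    (fun s hs => by
      have := A (t - s) (t + s) (by linarith [hs.1])
      linarith)
  simp only [add_zero, sub_zero] at this
  have e : g (t + τ) + g (t - τ) - 2 * g t = g (t + τ) + g (t - τ) - (g t + g t) := by ring
  rw [e]; linarith

lemma const_of_mid {l : ℝ → ℝ} {L : ℝ} (hL : ∀ t, |l t| ≤ L)
    (h : ∀ t τ, 0 ≤ τ → l (t + τ) + l (t - τ) = 2 * l t) (t τ : ℝ) : l (t + τ) = l t := by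
  have key : ∀ t τ, 0 ≤ τ → l (t + τ) = l t := by
    intro t τ hτ
    have ind : ∀ n : ℕ, l (t + n * τ) = l t + n * (l (t + τ) - l t) ∧
        l (t + (n + 1 : ℕ) * τ) = l t + (n + 1 : ℕ) * (l (t + τ) - l t) := by
      intro n
      induction n with
      | zero => simp
      | succ n ih =>
        refine ⟨ih.2, ?_⟩
        have := h (t + (n + 1 : ℕ) * τ) τ hτ
        have e1 : t + (n + 1 : ℕ) * τ - τ = t + n * τ := by push_cast; ring
        have e2 : t + (n + 1 : ℕ) * τ + τ = t + (n + 1 + 1 : ℕ) * τ := by push_cast; ring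
        rw [e1, e2, ih.1, ih.2] at this
        push_cast at this ⊢
        linarith
    by_contra hne
    have hd : 0 < |l (t + τ) - l t| := abs_pos.2 (sub_ne_zero.2 hne)
    obtain ⟨n, hn⟩ := exists_nat_gt (2 * L / |l (t + τ) - l t|)
    rw [div_lt_iff₀ hd] at hn
    have h1 := hL (t + n * τ)
    have h2 := hL t
    have h3 : n * |l (t + τ) - l t| = |l (t + n * τ) - l t| := by
      rw [(ind n).1]
      rw [add_sub_cancel_left, abs_mul, Nat.abs_cast]
    have h4 := abs_sub (l (t + n * τ)) (l t)
    linarith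
  rcases le_total 0 τ with h1 | h1
  · exact key t τ h1
  · have := key (t + τ) (-τ) (by linarith)
    rw [← this]; congr 1; ring

end

end


section

section
variable {w wt wr wtt wtr wrr : ℝ → ℝ → ℝ}

lemma decay1 {A E C : ℝ} {Q : ℝ → ℝ} (hw : C2Plane w wt wr wtt wtr wrr)
    (hx : ExtBound A E w wt wr) (hC : 0 ≤ C) (hQ : ∀ r, 1 ≤ r → |Real.sin (Q r)| ≤ C / r)
    (heq : ∀ t r, 1 ≤ r → wtt t r - wrr t r + 2 * w t r / r ^ 2 = Fn Q r (w t r)) :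
    ∃ W, 0 ≤ W ∧ ∀ t r, 1 ≤ r → |w t r| ≤ W := by
  have hA := hx.A_nonneg
  set C1 := (3 + 4 * (C + A) ^ 2) * A with hC1
  have hC1' : 0 ≤ C1 := by positivity
  have hF : ∀ t r, 1 ≤ r → |wtt t r - wrr t r + 2 * w t r / r ^ 2| ≤ C1 / r ^ (0 + 2) := by
    intro t r hr
    rw [heq t r hr]
    have hr0 : 0 < r := by linarith
    have hs1 : 1 ≤ √r := by rw [Real.one_le_sqrt]; exact hr
    have hs : √r * √r = r := Real.mul_self_sqrt hr0.le
    have hb := hx.hA t r hr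
    have := Fn_lip (w2 := 0) (W := A * √r) hC hr (hQ r hr) hb (by simp; positivity)
    rw [Fn_zero, sub_zero, sub_zero] at this
    refine this.trans ?_
    have e1 : 3 + 4 * (C + A * √r) ^ 2 ≤ (3 + 4 * (C + A) ^ 2) * r := by
      have : C + A * √r ≤ (C + A) * √r := by nlinarith
      have : (C + A * √r) ^ 2 ≤ ((C + A) * √r) ^ 2 := by gcongr
      nlinarith
    have e2 : √r ≤ r := by nlinarith
    calc (3 + 4 * (C + A * √r) ^ 2) / r ^ 4 * |w t r|
        ≤ ((3 + 4 * (C + A) ^ 2) * r) / r ^ 4 * (A * r) := by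
          gcongr
          exact hb.trans (by gcongr)
      _ = C1 / r ^ (0 + 2) := by rw [hC1]; field_simp
  have hH := fun t r hr => H_bound hw hx 0 le_rfl hF (t0 := t) (r0 := r) hr
  refine ⟨A + 2 * C1, by positivity, fun t r hr => ?_⟩
  have hr0 : 0 < r := by linarith
  have h1 := rw_growth (f := w t) (f' := wr t) (B := 2 * C1) (fun r => hw.c0.dr t r)
    (fun r hr => by simpa using hH t r hr) hr
  have h2 := hx.hA t 1 le_rfl
  simp only [Real.sqrt_one, mul_one] at h2
  have h3 : |r * w t r| ≤ A + 2 * C1 * (r - 1) := by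
    have := abs_sub_abs_le_abs_sub (r * w t r) (w t 1)
    linarith
  rw [abs_mul, abs_of_pos hr0] at h3
  have h4 : r * |w t r| ≤ r * (A + 2 * C1) := by nlinarith
  exact le_of_mul_le_mul_left h4 hr0

lemma lim_const {C2 W : ℝ} (hw : C2Plane w wt wr wtt wtr wrr)
    (hW : ∀ t r, 1 ≤ r → |w t r| ≤ W)
    (hF : ∀ t r, 1 ≤ r → |wtt t r - wrr t r + 2 * w t r / r ^ 2| ≤ C2 / r ^ (2 + 2))
    (hH : ∀ t r, 1 ≤ r → |wr t r + w t r / r| ≤ 2 * C2 / r ^ 3) (t τ r : ℝ) (hr : 1 ≤ r) :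
    |w (t + τ) r - w t r| ≤ 4 * C2 / r ^ 2 := by
  have hC2 : 0 ≤ C2 := by
    have h1 := (abs_nonneg _).trans (hF 0 1 le_rfl)
    simpa using h1
  have hc : ∀ t a b, 1 ≤ a → a ≤ b → |b * w t b - a * w t a| ≤ 2 * C2 / a := fun t a b ha hab =>
    rw_cauchy (fun r => hw.c0.dr t r) le_rfl (hH t) ha hab
  choose l hl1 hl2 using fun t => exists_lim (hc t)
  have hL : ∀ t, |l t| ≤ W + 2 * C2 := by
    intro t
    have h1 := hl2 t 1 le_rfl
    have h2 := hW t 1 le_rfl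
    simp only [one_mul, div_one] at h1
    have := abs_sub_abs_le_abs_sub (l t) (w t 1)
    rw [abs_sub_comm] at h1
    linarith
  -- averages
  have cw : ∀ t, Continuous (w t) := fun t => hw.c0.cf.comp (Continuous.prodMk_right t)
  have ckw : ∀ t, Continuous (fun ρ => kap ρ * w t ρ) := fun t => kap_cont.mul (cw t)
  have havg : ∀ t R, 1 ≤ R → |2 * R * (∫ ρ in R..(2 * R), kap ρ * w t ρ) - l t| ≤ 2 * C2 / R := by
    intro t R hR
    have hR0 : 0 < R := by linarith
    have := abs_sub_le_of_deriv (a := R) (b := 2 * R)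
      (X := fun x => (∫ ρ in R..x, kap ρ * w t ρ) + l t / x)
      (X' := fun x => kap x * w t x + (- l t / x ^ 2))
      (B := fun s => (2 * C2 / R) * (-(1 / (((0 : ℕ) + 1) * (0 + s) ^ (0 + 1)))))
      (B' := fun s => (2 * C2 / R) * (1 / (0 + s) ^ (0 + 2))) (by linarith)
      (fun s hs => by
        refine HasDerivAt.add (intervalIntegral.integral_hasDerivAt_right
          ((ckw t).intervalIntegrable _ _)
          (ckw t).aestronglyMeasurable.stronglyMeasurableAtFilter (ckw t).continuousAt) ?_
        have hs0 : s ≠ 0 := by linarith [hs.1]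
        refine ((hasDerivAt_const s (l t)).div (hasDerivAt_id s) hs0).congr_deriv ?_
        simp)
      (fun s hs => (hasDerivAt_inv_pow 0 0 (by linarith [hs.1])).const_mul _)
      (fun s hs => by
        have hs0 : 0 < s := by linarith [hs.1]
        have hs1 : 1 ≤ s := by linarith [hs.1]
        rw [kap_eq hs1]
        have e : 1 / s * w t s + -l t / s ^ 2 = (s * w t s - l t) / s ^ 2 := by field_simp; ring
        rw [e, abs_div, abs_of_pos (by positivity : 0 < s ^ 2)]
        have h1 := hl2 t s hs1
        have h2 : 2 * C2 / s ≤ 2 * C2 / R := by have := hs.1; gcongr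
        calc |s * w t s - l t| / s ^ 2 ≤ (2 * C2 / R) / s ^ 2 := by
              have := h1.trans h2; gcongr
          _ = _ := by simp only [zero_add]; ring)
    simp only [intervalIntegral.integral_same, zero_add] at this
    set I := ∫ ρ in R..(2 * R), kap ρ * w t ρ
    have e1 : I + l t / (2 * R) - l t / R = (2 * R * I - l t) / (2 * R) := by field_simp; ring
    have e2 : 2 * C2 / R * -(1 / (((0 : ℕ) + 1) * (2 * R) ^ 1)) - 2 * C2 / R * -(1 / (((0 : ℕ) + 1) * R ^ 1))
      = (2 * C2 / R) / (2 * R) := by push_cast; field_simp; ring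
    rw [e1, e2, abs_div, abs_of_pos (by positivity : 0 < 2 * R)] at this
    exact (div_le_div_iff_of_pos_right (by positivity)).1 this
  have hsec : ∀ R, 1 ≤ R → ∀ t, |∫ ρ in R..(2 * R), kap ρ * wtt t ρ| ≤ 5 * C2 / R ^ 4 := by
    intro R hR t
    have hR0 : 0 < R := by linarith
    rw [flux_identity hw hR (by linarith : R ≤ 2 * R)]
    have h1 := abs_integral_F_le (F := fun ρ => wtt t ρ - wrr t ρ + 2 * w t ρ / ρ ^ 2) 2
      (hF t) le_rfl hR (by linarith : R ≤ 2 * R)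
    have h2 : ∀ x, R ≤ x → |(wr t x + w t x / x) / x| ≤ 2 * C2 / R ^ 4 := by
      intro x hx
      have hx0 : 0 < x := by linarith
      rw [abs_div, abs_of_pos hx0]
      calc _ ≤ (2 * C2 / x ^ 3) / x := by
            have := hH t x (by linarith); gcongr
        _ = 2 * C2 / x ^ 4 := by field_simp
        _ ≤ _ := by gcongr
    have h3 := h2 R le_rfl
    have h4 := h2 (2 * R) (by linarith)
    have e : 5 * C2 / R ^ 4 = C2 / R ^ 4 + (2 * C2 / R ^ 4 + 2 * C2 / R ^ 4) := by ring
    rw [e]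
    refine (abs_add_le _ _).trans (add_le_add h1 ((abs_sub _ _).trans (add_le_add h4 h3)))
  have ckw0 : Continuous (fun p : ℝ × ℝ => kap p.2 * w p.1 p.2) :=
    (kap_cont.comp continuous_snd).mul hw.c0.cf
  have ckw1 : Continuous (fun p : ℝ × ℝ => kap p.2 * wt p.1 p.2) :=
    (kap_cont.comp continuous_snd).mul hw.c0.ct
  have ckw2 : Continuous (fun p : ℝ × ℝ => kap p.2 * wtt p.1 p.2) :=
    (kap_cont.comp continuous_snd).mul hw.c1.ct
  have hmid : ∀ t τ, 0 ≤ τ → l (t + τ) + l (t - τ) = 2 * l t := by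
    intro t τ hτ
    have hb : ∀ R, 1 ≤ R → |l (t + τ) + l (t - τ) - 2 * l t| ≤ (10 * C2 * τ ^ 2 + 8 * C2) / R := by
      intro R hR
      have hR0 : 0 < R := by linarith
      have h1 := second_diff (g := fun t => ∫ ρ in R..(2 * R), kap ρ * w t ρ)
        (g' := fun t => ∫ ρ in R..(2 * R), kap ρ * wt t ρ)
        (g'' := fun t => ∫ ρ in R..(2 * R), kap ρ * wtt t ρ)
        (fun t => C1Plane.hasDerivAt_param (f := fun t ρ => kap ρ * w t ρ)
          (ft := fun t ρ => kap ρ * wt t ρ) ckw0 ckw1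
          (fun t r => (hw.c0.dt t r).const_mul _) R (2 * R) t)
        (fun t => C1Plane.hasDerivAt_param (f := fun t ρ => kap ρ * wt t ρ)
          (ft := fun t ρ => kap ρ * wtt t ρ) ckw1 ckw2
          (fun t r => (hw.c1.dt t r).const_mul _) R (2 * R) t)
        (hsec R hR) t hτ
      have h2 := havg (t + τ) R hR
      have h3 := havg (t - τ) R hR
      have h4 := havg t R hR
      generalize (∫ ρ in R..(2 * R), kap ρ * w (t + τ) ρ) = I1 at *
      generalize (∫ ρ in R..(2 * R), kap ρ * w (t - τ) ρ) = I2 at *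
      generalize (∫ ρ in R..(2 * R), kap ρ * w t ρ) = I3 at *
      have h5 : |2 * R * (I1 + I2 - 2 * I3)| ≤ 10 * C2 * τ ^ 2 / R := by
        rw [abs_mul, abs_of_pos (by positivity : 0 < 2 * R)]
        calc _ ≤ 2 * R * (5 * C2 / R ^ 4 * τ ^ 2) := by gcongr
          _ = 10 * C2 * τ ^ 2 / R ^ 3 := by field_simp; ring
          _ ≤ _ := by
            have : R ≤ R ^ 3 := by nlinarith [mul_pos hR0 hR0]
            gcongr
      have e : (10 * C2 * τ ^ 2 + 8 * C2) / R = 10 * C2 * τ ^ 2 / R + 4 * (2 * C2 / R) := by ring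
      rw [e]
      rw [abs_le] at h2 h3 h4 h5 ⊢
      constructor <;> nlinarith
    have h0 : |l (t + τ) + l (t - τ) - 2 * l t| ≤ 0 := by
      refine ge_of_tendsto (tendsto_const_nhds.div_atTop tendsto_id)
        ((eventually_ge_atTop 1).mono fun R hR => hb R hR)
    have := abs_nonpos_iff.1 h0
    linarith
  have hconst := const_of_mid hL hmid t τ
  have h1 := hl2 (t + τ) r hr
  have h2 := hl2 t r hr
  rw [hconst] at h1
  have hr0 : 0 < r := by linarith
  have h3 : |r * (w (t + τ) r - w t r)| ≤ 4 * C2 / r := by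
    have e : r * (w (t + τ) r - w t r) = (r * w (t + τ) r - l t) - (r * w t r - l t) := by ring
    rw [e]
    refine (abs_sub _ _).trans ?_
    have : 4 * C2 / r = 2 * C2 / r + 2 * C2 / r := by ring
    linarith
  rw [abs_mul, abs_of_pos hr0] at h3
  have e : 4 * C2 / r ^ 2 = (4 * C2 / r) / r := by field_simp
  rw [e, le_div_iff₀ hr0]
  linarith

end

end


section

section
variable {w wt wr wtt wtr wrr : ℝ → ℝ → ℝ}

lemma C2Plane.tdiff (hw : C2Plane w wt wr wtt wtr wrr) (τ : ℝ) :
    C2Plane (fun t r => w (t + τ) r - w t r) (fun t r => wt (t + τ) r - wt t r)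
      (fun t r => wr (t + τ) r - wr t r) (fun t r => wtt (t + τ) r - wtt t r)
      (fun t r => wtr (t + τ) r - wtr t r) (fun t r => wrr (t + τ) r - wrr t r) :=
  ⟨(hw.c0.shift τ).sub hw.c0, (hw.c1.shift τ).sub hw.c1, (hw.c2.shift τ).sub hw.c2⟩

lemma ExtBound.tdiff {A E : ℝ} (hw : C2Plane w wt wr wtt wtr wrr) (hx : ExtBound A E w wt wr)
    (τ : ℝ) : ExtBound (2 * A) (4 * E) (fun t r => w (t + τ) r - w t r)
      (fun t r => wt (t + τ) r - wt t r) (fun t r => wr (t + τ) r - wr t r) := by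
  have ce : ∀ t, Continuous (edens w wt wr t) := fun t =>
    (edens_cont hw).comp (Continuous.prodMk_right t)
  have cz : ∀ t, Continuous (edens (fun t r => w (t + τ) r - w t r)
      (fun t r => wt (t + τ) r - wt t r) (fun t r => wr (t + τ) r - wr t r) t) := fun t =>
    (edens_cont (hw.tdiff τ)).comp (Continuous.prodMk_right t)
  have key : ∀ t a b e, a ≤ b → (∀ t, ∫ r in a..b, edens w wt wr t r ≤ e) →
      ∫ r in a..b, edens (fun t r => w (t + τ) r - w t r)
      (fun t r => wt (t + τ) r - wt t r) (fun t r => wr (t + τ) r - wr t r) t r ≤ 4 * e := by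
    intro t a b e hab h
    have h1 : ∫ r in a..b, edens (fun t r => w (t + τ) r - w t r)
      (fun t r => wt (t + τ) r - wt t r) (fun t r => wr (t + τ) r - wr t r) t r ≤
      ∫ r in a..b, (2 * edens w wt wr (t + τ) r + 2 * edens w wt wr t r) := by
      refine intervalIntegral.integral_mono_on hab ((cz t).intervalIntegrable _ _)
        (((continuous_const.mul (ce _)).add (continuous_const.mul (ce _))).intervalIntegrable _ _) ?_
      intro r _
      unfold edens
      generalize 2 * r / (r ^ 2 + 1) = c
      nlinarith [sq_nonneg (wt (t + τ) r + wt t r),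
        sq_nonneg (wr (t + τ) r - c * w (t + τ) r + (wr t r - c * w t r))]
    have i1 := (ce (t + τ)).intervalIntegrable (μ := volume) a b
    have i2 := (ce t).intervalIntegrable (μ := volume) a b
    rw [intervalIntegral.integral_add (i1.const_mul 2) (i2.const_mul 2),
      intervalIntegral.integral_const_mul, intervalIntegral.integral_const_mul] at h1
    have := h t
    have := h (t + τ)
    linarith
  refine ⟨fun t r hr => ?_, fun t a b ha hab => key t a b E hab fun t => hx.hE t a b ha hab,
    fun ε hε => ?_⟩
  · refine (abs_sub _ _).trans ?_
    have := hx.hA t r hr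
    have := hx.hA (t + τ) r hr
    linarith
  · obtain ⟨ρ, h1, h2⟩ := hx.tail (ε / 4) (by positivity)
    refine ⟨ρ, h1, fun t a b ha hab => ?_⟩
    have := key t a b (ε / 4) hab fun t => h2 t a b ha hab
    linarith

theorem far_static {A E C : ℝ} {Q : ℝ → ℝ} (hw : C2Plane w wt wr wtt wtr wrr)
    (hx : ExtBound A E w wt wr) (hC : 0 ≤ C) (hQ : ∀ r, 1 ≤ r → |Real.sin (Q r)| ≤ C / r)
    (heq : ∀ t r, 1 ≤ r → wtt t r - wrr t r + 2 * w t r / r ^ 2 = Fn Q r (w t r)) :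
    ∃ R0, 1 ≤ R0 ∧ ∀ t τ r, R0 ≤ r → w (t + τ) r = w t r := by
  obtain ⟨W, hW0, hW⟩ := decay1 hw hx hC hQ heq
  set K := 3 + 4 * (C + W) ^ 2 with hK
  have hKp : 0 < K := by positivity
  have hF : ∀ t r, 1 ≤ r → |wtt t r - wrr t r + 2 * w t r / r ^ 2| ≤ (K * W) / r ^ (2 + 2) := by
    intro t r hr
    have hr0 : 0 < r := by linarith
    rw [heq t r hr]
    have := Fn_lip (w2 := 0) hC hr (hQ r hr) (hW t r hr) (by simpa using hW0)
    rw [Fn_zero, sub_zero, sub_zero, ← hK] at this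
    refine this.trans ?_
    calc K / r ^ 4 * |w t r| ≤ K / r ^ 4 * W := by have := hW t r hr; gcongr
      _ = _ := by ring
  have hH := fun t r hr => H_bound hw hx 2 le_rfl hF (t0 := t) (r0 := r) hr
  have hlim := lim_const hw hW hF hH
  set M := 4 * (K * W) with hM
  have hM0 : 0 ≤ M := by positivity
  refine ⟨1 + 4 * K, by linarith, fun t τ => ?_⟩
  set R0 := 1 + 4 * K with hR0
  have hR1 : 1 ≤ R0 := by linarith
  have hKR : 4 * K ≤ R0 ^ 2 := by nlinarith
  have claim : ∀ n : ℕ, ∀ t r, R0 ≤ r → |w (t + τ) r - w t r| ≤ (M / 2 ^ n) / r ^ 2 := by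
    intro n
    induction n with
    | zero => intro t r hr; simpa using hlim t τ r (by linarith)
    | succ n ih =>
      set m := M / 2 ^ n with hm
      have hm0 : 0 ≤ m := by positivity
      have hzF : ∀ t r, R0 ≤ r → |(wtt (t + τ) r - wtt t r) - (wrr (t + τ) r - wrr t r)
          + 2 * (w (t + τ) r - w t r) / r ^ 2| ≤ (m / 4) / r ^ (2 + 2) := by
        intro t r hr
        have hr1 : 1 ≤ r := by linarith
        have hr0 : 0 < r := by linarith
        have e : (wtt (t + τ) r - wtt t r) - (wrr (t + τ) r - wrr t r)
          + 2 * (w (t + τ) r - w t r) / r ^ 2 = Fn Q r (w (t + τ) r) - Fn Q r (w t r) := by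
          rw [← heq _ _ hr1, ← heq _ _ hr1]; ring
        rw [e]
        refine (Fn_lip hC hr1 (hQ r hr1) (hW _ r hr1) (hW _ r hr1)).trans ?_
        rw [← hK]
        have h1 : |w (t + τ) r - w t r| ≤ m / (4 * K) := by
          refine (ih t r hr).trans ?_
          have : 4 * K ≤ r ^ 2 := hKR.trans (by gcongr)
          gcongr
        calc K / r ^ 4 * |w (t + τ) r - w t r| ≤ K / r ^ 4 * (m / (4 * K)) := by gcongr
          _ = _ := by field_simp; try ring
      have hzH := fun t r hr => H_bound (hw.tdiff τ) (hx.tdiff hw τ) 2 hR1 hzF (t0 := t) (r0 := r) hr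
      intro t a ha
      have ha0 : 0 < a := by linarith
      have hc : ∀ b, a ≤ b → |b * (w (t + τ) b - w t b) - a * (w (t + τ) a - w t a)|
          ≤ (2 * (m / 4)) / a := fun b hb =>
        rw_cauchy (fun r => (hw.tdiff τ).c0.dr t r) hR1 (hzH t) ha hb
      have hlim0 : Tendsto (fun b => b * (w (t + τ) b - w t b)) atTop (nhds 0) := by
        refine squeeze_zero_norm' ?_ ((tendsto_const_nhds (x := m)).div_atTop tendsto_id)
        filter_upwards [eventually_ge_atTop a] with b hb
        have hb0 : 0 < b := by linarith
        rw [Real.norm_eq_abs, abs_mul, abs_of_pos hb0]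
        calc _ ≤ b * (m / b ^ 2) := by have := ih t b (by linarith); gcongr
          _ = _ := by simp only [id]; field_simp
      have hl := (hlim0.sub_const (a * (w (t + τ) a - w t a))).abs
      have := le_of_tendsto hl ((eventually_ge_atTop a).mono hc)
      rw [zero_sub, abs_neg, abs_mul, abs_of_pos ha0] at this
      have e : M / 2 ^ (n + 1) / a ^ 2 = (2 * (m / 4)) / a / a := by
        rw [hm, pow_succ]; field_simp; ring
      rw [e, le_div_iff₀ ha0]
      linarith
  intro r hr
  have h1 : Tendsto (fun n : ℕ => (M / 2 ^ n) / r ^ 2) atTop (nhds 0) := by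
    have : Tendsto (fun n : ℕ => M / (2 : ℝ) ^ n) atTop (nhds 0) :=
      tendsto_const_nhds.div_atTop (tendsto_pow_atTop_atTop_of_one_lt (by norm_num))
    simpa using this.div_const (r ^ 2)
  have := ge_of_tendsto h1 (Eventually.of_forall fun n => claim n t r hr)
  exact sub_eq_zero.1 (abs_nonpos_iff.1 this)

end

end


section

section
variable {z zt zr ztt ztr zrr : ℝ → ℝ → ℝ}

lemma strip_step (hz : C2Plane z zt zr ztt ztr zrr) {ρ M : ℝ}
    (heq : ∀ t r, |ztt t r - zrr t r| ≤ 3 * |z t r|)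
    (h0 : ∀ t r, ρ ≤ r → z t r = 0) (hM : ∀ t r, ρ - 1 / 6 ≤ r → |z t r| ≤ M) :
    ∀ t r, ρ - 1 / 6 ≤ r → |z t r| ≤ M / 3 := by
  have hzt : ∀ t r, ρ < r → zt t r = 0 := by
    intro t r hr
    have h1 := hz.c0.dt t r
    have e : (fun s => z s r) = fun _ => 0 := funext fun s => h0 s r hr.le
    rw [e] at h1
    exact h1.unique (hasDerivAt_const _ _)
  have hzr : ∀ t r, ρ < r → zr t r = 0 := by
    intro t r hr
    have h1 := hz.c0.dr t r
    have e : (fun s => z t s) =ᶠ[nhds r] fun _ => 0 := by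
      filter_upwards [lt_mem_nhds hr] with s hs
      exact h0 t s hs.le
    exact (h1.congr_of_eventuallyEq e.symm).unique (hasDerivAt_const _ _)
  have hp : ∀ t r, ρ - 1 / 6 ≤ r → |zt t r + zr t r| ≤ M := by
    intro t r hr
    have := abs_sub_le_of_deriv (a := 0) (b := 1 / 3)
      (X := fun s => zt (t - s) (r + s) + zr (t - s) (r + s))
      (X' := fun s => (-1 * ztt (t - s) (r + s) + 1 * ztr (t - s) (r + s))
        + (-1 * ztr (t - s) (r + s) + 1 * zrr (t - s) (r + s)))
      (B := fun s => (3 * M) * s) (B' := fun _ => 3 * M) (by norm_num)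
      (fun s _ => by
        have d1 : HasDerivAt (fun s => t - s) (-1) s := by
          simpa using (hasDerivAt_id s).const_sub t
        have d2 : HasDerivAt (fun s => r + s) 1 s := by
          simpa using (hasDerivAt_id s).const_add r
        exact (hz.c1.curve d1 d2).add (hz.c2.curve d1 d2))
      (fun s _ => by simpa using (hasDerivAt_id s).const_mul (3 * M))
      (fun s hs => by
        have h1 := heq (t - s) (r + s)
        have h2 := hM (t - s) (r + s) (by linarith [hs.1])
        have e : (-1 * ztt (t - s) (r + s) + 1 * ztr (t - s) (r + s))
          + (-1 * ztr (t - s) (r + s) + 1 * zrr (t - s) (r + s))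
          = -(ztt (t - s) (r + s) - zrr (t - s) (r + s)) := by ring
        rw [e, abs_neg]; linarith)
    simp only [sub_zero, add_zero] at this
    rw [hzt _ _ (by linarith), hzr _ _ (by linarith), add_zero, zero_sub, abs_neg] at this
    linarith
  have hm : ∀ t r, ρ - 1 / 6 ≤ r → |zt t r - zr t r| ≤ M := by
    intro t r hr
    have := abs_sub_le_of_deriv (a := 0) (b := 1 / 3)
      (X := fun s => zt (t + s) (r + s) - zr (t + s) (r + s))
      (X' := fun s => (1 * ztt (t + s) (r + s) + 1 * ztr (t + s) (r + s))
        - (1 * ztr (t + s) (r + s) + 1 * zrr (t + s) (r + s)))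
      (B := fun s => (3 * M) * s) (B' := fun _ => 3 * M) (by norm_num)
      (fun s _ => by
        have d1 : HasDerivAt (fun s => t + s) 1 s := by
          simpa using (hasDerivAt_id s).const_add t
        have d2 : HasDerivAt (fun s => r + s) 1 s := by
          simpa using (hasDerivAt_id s).const_add r
        exact (hz.c1.curve d1 d2).sub (hz.c2.curve d1 d2))
      (fun s _ => by simpa using (hasDerivAt_id s).const_mul (3 * M))
      (fun s hs => by
        have h1 := heq (t + s) (r + s)
        have h2 := hM (t + s) (r + s) (by linarith [hs.1])
        have e : (1 * ztt (t + s) (r + s) + 1 * ztr (t + s) (r + s))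
          - (1 * ztr (t + s) (r + s) + 1 * zrr (t + s) (r + s))
          = (ztt (t + s) (r + s) - zrr (t + s) (r + s)) := by ring
        rw [e]; linarith)
    simp only [add_zero] at this
    rw [hzt _ _ (by linarith), hzr _ _ (by linarith), sub_zero, zero_sub, abs_neg] at this
    linarith
  have hr : ∀ t r, ρ - 1 / 6 ≤ r → |zr t r| ≤ M := by
    intro t r hr
    have h1 := abs_le.1 (hp t r hr)
    have h2 := abs_le.1 (hm t r hr)
    rw [abs_le]; constructor <;> linarith [h1.1, h1.2, h2.1, h2.2]
  intro t r hr'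
  have := abs_sub_le_of_deriv (a := r) (b := r + 1 / 3) (X := z t) (X' := zr t)
    (B := fun s => M * s) (B' := fun _ => M) (by linarith) (fun s _ => hz.c0.dr t s)
    (fun s _ => by simpa using (hasDerivAt_id s).const_mul M)
    (fun s hs => hr t s (by linarith [hs.1]))
  rw [h0 t (r + 1 / 3) (by linarith), zero_sub, abs_neg] at this
  linarith

theorem sideways (hz : C2Plane z zt zr ztt ztr zrr) {ρ : ℝ}
    (heq : ∀ t r, |ztt t r - zrr t r| ≤ 3 * |z t r|)
    (h0 : ∀ t r, ρ ≤ r → z t r = 0) (hM : ∀ a, ∃ M, ∀ t r, a ≤ r → |z t r| ≤ M) (t r : ℝ) :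
    z t r = 0 := by
  have claim : ∀ n : ℕ, ∀ t r, ρ - n * (1 / 6) ≤ r → z t r = 0 := by
    intro n
    induction n with
    | zero => intro t r hr; exact h0 t r (by simpa using hr)
    | succ n ih =>
      obtain ⟨M, hM⟩ := hM (ρ - n * (1 / 6) - 1 / 6)
      have cl : ∀ k : ℕ, ∀ t r, ρ - n * (1 / 6) - 1 / 6 ≤ r → |z t r| ≤ M / 3 ^ k := by
        intro k
        induction k with
        | zero => simpa using hM
        | succ k ihk =>
          intro t r hr
          have := strip_step hz heq ih ihk t r hr
          rwa [div_div, ← pow_succ] at this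
      intro t r hr
      have hr' : ρ - n * (1 / 6) - 1 / 6 ≤ r := by push_cast at hr; linarith
      have h1 : Tendsto (fun k : ℕ => M / (3 : ℝ) ^ k) atTop (nhds 0) :=
        tendsto_const_nhds.div_atTop (tendsto_pow_atTop_atTop_of_one_lt (by norm_num))
      have := ge_of_tendsto h1 (Eventually.of_forall fun k => cl k t r hr')
      exact abs_nonpos_iff.1 this
  obtain ⟨n, hn⟩ := exists_nat_gt ((ρ - r) * 6)
  exact claim n t r (by linarith)

end

end


section

section
variable {u ut ur utt utr urr : ℝ → ℝ → ℝ}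

lemma w_of (hu : C2Plane u ut ur utt utr urr) :
    C2Plane (fun t r => (r ^ 2 + 1) * u t r) (fun t r => (r ^ 2 + 1) * ut t r)
      (fun t r => 2 * r * u t r + (r ^ 2 + 1) * ur t r) (fun t r => (r ^ 2 + 1) * utt t r)
      (fun t r => 2 * r * ut t r + (r ^ 2 + 1) * utr t r)
      (fun t r => (2 * u t r + 2 * r * ur t r) + (2 * r * ur t r + (r ^ 2 + 1) * urr t r)) := by
  have d1 : ∀ r : ℝ, HasDerivAt (fun r : ℝ => r ^ 2 + 1) (2 * r) r := fun r => by
    simpa using (hasDerivAt_pow 2 r).add_const 1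
  have d2 : ∀ r : ℝ, HasDerivAt (fun r : ℝ => 2 * r) 2 r := fun r => by
    simpa using (hasDerivAt_id r).const_mul 2
  have c1 : Continuous (fun r : ℝ => 2 * r) := by fun_prop
  have c2 : Continuous (fun _ : ℝ => (2 : ℝ)) := by fun_prop
  exact ⟨hu.c0.smul d1 c1, hu.c1.smul d1 c1, (hu.c0.smul d2 c2).add (hu.c2.smul d1 c1)⟩

lemma w_eq {Q : ℝ → ℝ} {r u0 ur0 utt0 urr0 : ℝ}
    (h : utt0 - urr0 - (4 * r / (r ^ 2 + 1)) * ur0 + Vpot Q r * u0 = Npot Q r u0) :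
    (r ^ 2 + 1) * utt0 - ((2 * u0 + 2 * r * ur0) + (2 * r * ur0 + (r ^ 2 + 1) * urr0))
      = - Gn Q r ((r ^ 2 + 1) * u0) := by
  have hj := jb_pos r
  have hj2 := jb_sq r
  unfold Vpot Npot at h
  have e0 : √(r ^ 2 + 1) = jb r := rfl
  have e1 : (r ^ 2 + 1) * u0 / jb r = jb r * u0 := by rw [← hj2]; field_simp
  have e2 : 2 * √(r ^ 2 + 1) * u0 = 2 * (jb r * u0) := by rw [e0]; ring
  rw [e2, e0] at h
  unfold Gn
  rw [e1, Real.sin_add, Real.cos_two_mul (jb r * u0), Real.cos_sq']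
  rw [← hj2] at h ⊢
  set a := jb r * u0 with ha
  have h' : utt0 - urr0 = (4 * r / (jb r ^ 2)) * ur0
    - (1 / (jb r ^ 2) ^ 2 + 2 / (jb r ^ 2) * (Real.cos (2 * Q r) - 1)) * u0
    + (2 * Real.sin a ^ 2 * Real.sin (2 * Q r) / jb r ^ 3
    + (2 * a - Real.sin (2 * a)) * Real.cos (2 * Q r) / jb r ^ 3) := by linarith
  have e3 : jb r ^ 2 * utt0 - ((2 * u0 + 2 * r * ur0) + (2 * r * ur0 + jb r ^ 2 * urr0))
    = jb r ^ 2 * (utt0 - urr0) - 2 * u0 - 4 * r * ur0 := by ring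
  rw [e3, h', ha]
  field_simp
  ring

lemma C2Plane.refl (hu : C2Plane u ut ur utt utr urr) :
    C2Plane (fun t r => u t (-r)) (fun t r => ut t (-r)) (fun t r => -ur t (-r))
      (fun t r => utt t (-r)) (fun t r => -utr t (-r)) (fun t r => urr t (-r)) := by
  refine ⟨hu.c0.refl, hu.c1.refl, ?_⟩
  simpa using hu.c2.refl.neg

lemma edens_refl (t r : ℝ) :
    edens (fun t r => u t (-r)) (fun t r => ut t (-r)) (fun t r => -ur t (-r)) t r
      = edens u ut ur t (-r) := by
  unfold edens
  rw [neg_sq]; ring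

/-- bound of `u` on bounded sets, from the energy -/
lemma u_bound (hu : C2Plane u ut ur utt utr urr) {E : ℝ}
    (hE : ∀ t a b, a ≤ b → ∫ r in a..b, (ur t r ^ 2 + ut t r ^ 2) * (r ^ 2 + 1) ^ 2 ≤ E)
    (t : ℝ) {a b : ℝ} (hab : a ≤ b) : |u t b - u t a| ≤ E + (b - a) := by
  have c1 : Continuous (ur t) := hu.c0.cr.comp (Continuous.prodMk_right t)
  have c2 : Continuous (ut t) := hu.c0.ct.comp (Continuous.prodMk_right t)
  have c3 : Continuous (fun r => (ur t r ^ 2 + ut t r ^ 2) * (r ^ 2 + 1) ^ 2) := by fun_prop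
  have := abs_sub_le_of_deriv (X := u t) (X' := ur t) hab (fun s _ => hu.c0.dr t s)
    (B := fun x => (∫ r in a..x, (ur t r ^ 2 + ut t r ^ 2) * (r ^ 2 + 1) ^ 2) + x)
    (B' := fun x => (ur t x ^ 2 + ut t x ^ 2) * (x ^ 2 + 1) ^ 2 + 1)
    (fun s _ => (intervalIntegral.integral_hasDerivAt_right (c3.intervalIntegrable _ _)
      c3.aestronglyMeasurable.stronglyMeasurableAtFilter c3.continuousAt).add (hasDerivAt_id s))
    (fun s _ => by
      have h1 : |ur t s| ≤ ur t s ^ 2 + 1 := by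
        rw [← sq_abs]; nlinarith [sq_nonneg (|ur t s| - 1), abs_nonneg (ur t s)]
      have h2 : ur t s ^ 2 ≤ (ur t s ^ 2 + ut t s ^ 2) * (s ^ 2 + 1) ^ 2 := by
        have : 1 ≤ (s ^ 2 + 1) ^ 2 := by nlinarith [sq_nonneg s]
        nlinarith [sq_nonneg (ur t s), sq_nonneg (ut t s)]
      linarith)
  simp only [intervalIntegral.integral_same] at this
  have := hE t a b hab
  linarith

lemma jb_deriv (r : ℝ) : HasDerivAt jb (r / jb r) r := by
  unfold jb
  have h : HasDerivAt (fun r : ℝ => r ^ 2 + 1) (2 * r) r := by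
    simpa using (hasDerivAt_pow 2 r).add_const 1
  refine (h.sqrt (by positivity)).congr_deriv ?_
  have := jb_pos r
  unfold jb at this
  field_simp

end

end


lemma lim_aux {A : ℝ} {f : ℝ → ℝ} (h : ∀ r, 1 ≤ r → |(r ^ 2 + 1) * f r| ≤ A * √r) :
    Tendsto (fun r => jb r * f r) atTop (nhds 0) := by
  have hs : Tendsto (fun r : ℝ => √r) atTop atTop := Real.tendsto_sqrt_atTop
  refine squeeze_zero_norm' ?_ ((tendsto_const_nhds (x := A)).div_atTop hs)
  filter_upwards [eventually_ge_atTop 1] with r hr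
  have hr0 : 0 < r := by linarith
  have h1 := h r hr
  have hj := jb_pos r
  have hjr := jb_ge hr0.le
  have hss := Real.mul_self_sqrt hr0.le
  have hsp := Real.sqrt_pos.2 hr0
  rw [← jb_sq, sq, mul_assoc, abs_mul, abs_of_pos hj] at h1
  rw [Real.norm_eq_abs, le_div_iff₀ hsp]
  have h2 : r * |jb r * f r| ≤ A * √r :=
    (mul_le_mul_of_nonneg_right hjr (abs_nonneg _)).trans h1
  have h3 : √r * (|jb r * f r| * √r) ≤ √r * A := by
    calc √r * (|jb r * f r| * √r) = (√r * √r) * |jb r * f r| := by ring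
      _ ≤ _ := by rw [hss]; linarith
  exact le_of_mul_le_mul_left h3 hsp

theorem stmt18 (n : ℕ) (Q : ℝ → ℝ) (hQ : IsHarmonicMapSol Q)
    (hQb : Tendsto Q atBot (nhds 0))
    (hQt : Tendsto Q atTop (nhds ((n : ℝ) * Real.pi)))
    (u : ℝ → ℝ → ℝ) (hu : SolvesReduced Q u)
    (hfin : FiniteEnergyReduced u) (hcomp : TotallyBoundedTraj u) :
    ∀ t r : ℝ, u t r = 0 ∧ deriv (fun s => u s r) t = 0 := by
  obtain ⟨hQ2, hode⟩ := hQ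
  have d0 : ∀ r, HasDerivAt Q (deriv Q r) r := fun r =>
    (hQ2.differentiable (by norm_num) r).hasDerivAt
  have hQ1 : ContDiff ℝ 1 (deriv Q) := by
    have : ContDiff ℝ (1 + 1) Q := by norm_num; exact hQ2
    exact (contDiff_succ_iff_deriv.1 this).2.2
  have d1 : ∀ r, HasDerivAt (deriv Q) (deriv (deriv Q) r) r := fun r =>
    (hQ1.differentiable (by norm_num) r).hasDerivAt
  obtain ⟨C, hC, hQC⟩ := sinQ_decay d0 d1 hode hQb hQt
  obtain ⟨hu2, heq⟩ := hu
  obtain ⟨ut, ur, utt, utr, urr, hP⟩ := exists_C2Plane hu2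
  have er : ∀ t, deriv (u t) = ur t := fun t => funext fun r => (hP.c0.dr t r).deriv
  have et : ∀ r, deriv (fun s => u s r) = fun t => ut t r :=
    fun r => funext fun t => (hP.c0.dt t r).deriv
  have err : ∀ t, deriv (ur t) = urr t := fun t => funext fun r => (hP.c2.dr t r).deriv
  have ett : ∀ r, deriv (fun t => ut t r) = fun t => utt t r :=
    fun r => funext fun t => (hP.c1.dt t r).deriv
  simp only [er, et, err, ett] at heq
  obtain ⟨⟨E, hE⟩, htail⟩ := energy_of_totallyBounded hP.c0 hfin hcomp
  have hw := w_of hP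
  set w : ℝ → ℝ → ℝ := fun t r => (r ^ 2 + 1) * u t r with hwdef
  have hweq := fun t r => w_eq (heq t r)
  -- energy density
  have hed : ∀ t r, edens w (fun t r => (r ^ 2 + 1) * ut t r)
      (fun t r => 2 * r * u t r + (r ^ 2 + 1) * ur t r) t r
      = (ur t r ^ 2 + ut t r ^ 2) * (r ^ 2 + 1) ^ 2 := by
    intro t r
    simp only [edens, hwdef]
    have : r ^ 2 + 1 ≠ 0 := by positivity
    field_simp
    ring
  have hE1 : ∀ t a b, a ≤ b → ∫ r in a..b, edens w (fun t r => (r ^ 2 + 1) * ut t r)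
      (fun t r => 2 * r * u t r + (r ^ 2 + 1) * ur t r) t r ≤ E := by
    intro t a b hab; simp only [hed]; exact hE t a b hab
  have hb1 := w_bound hw (fun t a b _ hab => hE1 t a b hab) (fun t r hr => by
    rw [hweq t r, abs_neg]; exact Gn_le hr)
  have hb2 := w_bound hw.refl (E := E) (fun t a b _ hab => by
    refine le_trans (le_of_eq (intervalIntegral.integral_congr
      (g := fun r => edens w (fun t r => (r ^ 2 + 1) * ut t r)
      (fun t r => 2 * r * u t r + (r ^ 2 + 1) * ur t r) t (-r)) (fun r _ => edens_refl (u := w)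
        (ut := fun t r => (r ^ 2 + 1) * ut t r)
        (ur := fun t r => 2 * r * u t r + (r ^ 2 + 1) * ur t r) t r))) ?_
    rw [intervalIntegral.integral_comp_neg (fun r => edens w (fun t r => (r ^ 2 + 1) * ut t r)
      (fun t r => 2 * r * u t r + (r ^ 2 + 1) * ur t r) t r)]
    exact hE1 t _ _ (by linarith)) (fun t r hr => by
    rw [hweq t (-r), abs_neg]
    have h1 := Gn_le (Q := fun x => Q (-x)) (w := w t (-r)) hr
    have h2 : Gn (fun x => Q (-x)) r (w t (-r)) = Gn Q (-r) (w t (-r)) := by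
      simp [Gn, jb]
    rwa [h2] at h1)
  have hx : ExtBound (2 * (E + 1)) E w (fun t r => (r ^ 2 + 1) * ut t r)
      (fun t r => 2 * r * u t r + (r ^ 2 + 1) * ur t r) :=
    ⟨hb1, fun t a b _ hab => hE1 t a b hab, fun ε hε => by
      obtain ⟨ρ, h1, h2⟩ := htail ε hε
      refine ⟨ρ, h1, fun t a b ha hab => ?_⟩
      simp only [hed]; exact h2 t a b ha hab⟩
  obtain ⟨R0, hR0, hfar⟩ := far_static hw hx hC hQC (fun t r _ => by
    rw [hweq t r]; unfold Fn; ring)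
  -- time independence
  have hstat : ∀ t τ r, w (t + τ) r = w t r := by
    intro t τ r
    have := sideways (hw.tdiff τ) (ρ := R0) (fun t r => by
        have e : ((r ^ 2 + 1) * utt (t + τ) r - (r ^ 2 + 1) * utt t r)
          - ((2 * u (t + τ) r + 2 * r * ur (t + τ) r) + (2 * r * ur (t + τ) r + (r ^ 2 + 1) * urr (t + τ) r)
          - ((2 * u t r + 2 * r * ur t r) + (2 * r * ur t r + (r ^ 2 + 1) * urr t r)))
          = -(Gn Q r (w (t + τ) r) - Gn Q r (w t r)) := by
          have h1 := hweq (t + τ) r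
          have h2 := hweq t r
          simp only [hwdef]
          linarith
        rw [e, abs_neg]
        exact Gn_lip Q r _ _)
      (fun t r hr => by rw [hfar t τ r hr, sub_self])
      (fun a => by
        set B := |u t R0| + 1 with hB
        have hu0 : ∀ t, |u t R0| ≤ 2 * (E + 1) * √R0 := fun t => by
          refine le_trans ?_ (hb1 t R0 hR0)
          simp only [hwdef]
          rw [abs_mul, abs_of_pos (by positivity : 0 < R0 ^ 2 + 1)]
          nlinarith [abs_nonneg (u t R0), sq_nonneg R0]
        have hE0 := hx.E_nonneg
        have hub : ∀ t r, a ≤ r → r ≤ R0 → |u t r| ≤ 2 * (E + 1) * √R0 + (E + (R0 - a)) := by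
          intro t r har hrR
          have h1 := u_bound hP hE t hrR
          have h2 := hu0 t
          have h3 := abs_sub_abs_le_abs_sub (u t r) (u t R0)
          rw [abs_sub_comm] at h3
          linarith
        set S := 2 * (E + 1) * √R0 + (E + |R0 - a|) with hS
        have hS0 : 0 ≤ S := by positivity
        refine ⟨(a ^ 2 + R0 ^ 2 + 1) * (2 * S), fun t r har => ?_⟩
        rcases le_total R0 r with h | h
        · rw [hfar t τ r h, sub_self, abs_zero]; positivity
        · have h1 := hub t r har h
          have h2 := hub (t + τ) r har h
          have h3 := le_abs_self (R0 - a)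
          simp only [hwdef]
          rw [← mul_sub, abs_mul, abs_of_pos (by positivity : 0 < r ^ 2 + 1)]
          have h4 := abs_sub (u (t + τ) r) (u t r)
          have h5 : r ^ 2 ≤ a ^ 2 + R0 ^ 2 := by
            rcases le_total 0 r with h0 | h0
            · nlinarith [sq_nonneg a]
            · nlinarith [sq_nonneg R0]
          have h6 : |u (t + τ) r - u t r| ≤ 2 * S := by linarith
          gcongr)
      t r
    exact sub_eq_zero.1 this
  have hus : ∀ t r, u t r = u 0 r := by
    intro t r
    have h1 := hstat 0 t r
    rw [zero_add] at h1
    simp only [hwdef] at h1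
    exact mul_left_cancel₀ (by positivity) h1
  have hut : ∀ t r, ut t r = 0 := by
    intro t r
    have h1 := hP.c0.dt t r
    have e : (fun s => u s r) = fun _ => u 0 r := funext fun s => hus s r
    rw [e] at h1
    exact h1.unique (hasDerivAt_const _ _)
  have hutt : ∀ t r, utt t r = 0 := by
    intro t r
    have h1 := hP.c1.dt t r
    have e : (fun s => ut s r) = fun _ => 0 := funext fun s => hut s r
    rw [e] at h1
    exact h1.unique (hasDerivAt_const _ _)
  -- the perturbed harmonic map
  have hrj : ∀ r, HasDerivAt (fun r => r / jb r) (1 / jb r ^ 3) r := fun r => by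
    have hj := jb_pos r
    have hj2 := jb_sq r
    refine ((hasDerivAt_id r).div (jb_deriv r) hj.ne').congr_deriv ?_
    simp only [id]
    field_simp
    linarith
  have e0 : ∀ r, HasDerivAt (fun r => Q r + jb r * u 0 r)
      (deriv Q r + (r / jb r * u 0 r + jb r * ur 0 r)) r := fun r =>
    (d0 r).add ((jb_deriv r).mul (hP.c0.dr 0 r))
  have e1 : ∀ r, HasDerivAt (fun r => deriv Q r + (r / jb r * u 0 r + jb r * ur 0 r))
      (deriv (deriv Q) r + ((1 / jb r ^ 3 * u 0 r + r / jb r * ur 0 r)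
        + (r / jb r * ur 0 r + jb r * urr 0 r))) r := fun r =>
    (d1 r).add (((hrj r).mul (hP.c0.dr 0 r)).add ((jb_deriv r).mul (hP.c2.dr 0 r)))
  have t1 : Tendsto (fun r => jb r * u 0 r) atTop (nhds 0) := lim_aux (fun r hr => hb1 0 r hr)
  have t2 : Tendsto (fun r => jb r * u 0 r) atBot (nhds 0) := by
    have h1 := lim_aux (f := fun r => u 0 (-r)) (A := 2 * (E + 1)) (fun r hr => by
      have := hb2 0 r hr
      simpa only [hwdef, neg_sq] using this)
    have h2 := h1.comp tendsto_neg_atBot_atTop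
    refine h2.congr fun r => ?_
    simp [jb]
  have huniq := Pend.unique (pend_of_ode d0 d1 hode hQb hQt)
    (pend_of_ode (n := n) e0 e1 (fun r => by
      have hj := jb_pos r
      have hj2 := jb_sq r
      have h1 := hweq 0 r
      rw [hutt] at h1
      have h2 := hode r
      unfold Gn at h1
      have e3 : (r ^ 2 + 1) * u 0 r / jb r = jb r * u 0 r := by rw [← hj2]; field_simp
      simp only [e3] at h1
      have e4 : 2 * (Q r + jb r * u 0 r) = 2 * Q r + 2 * (jb r * u 0 r) := by ring
      rw [e4]
      generalize Real.sin (2 * Q r + 2 * (jb r * u 0 r)) = s1 at *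
      generalize Real.sin (2 * Q r) = s2 at *
      generalize deriv (deriv Q) r = q2 at *
      generalize deriv Q r = q1 at *
      generalize u 0 r = a at *
      generalize ur 0 r = b at *
      generalize urr 0 r = c at *
      have hr2 : r ^ 2 = jb r ^ 2 - 1 := by linarith
      rw [← hj2] at h1 h2 ⊢
      generalize jb r = j at *
      have h3 : s1 = j * ((2 * a + 2 * r * b) + (2 * r * b + j ^ 2 * c) - j ^ 2 * a / (j ^ 2) ^ 2) + s2 := by
        have : (s1 - s2) / j = (2 * a + 2 * r * b) + (2 * r * b + j ^ 2 * c) - j ^ 2 * a / (j ^ 2) ^ 2 := by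
          linarith
        rw [← this]; field_simp; ring
      have h4 : q2 = s2 / j ^ 2 - 2 * r / j ^ 2 * q1 := by linarith
      rw [h3, h4]
      field_simp
      have hr3 : r ^ 2 = j ^ 2 - 1 := hr2
      ring_nf
      rw [hr3]
      ring) (by simpa using hQb.add t2) (by simpa using hQt.add t1))
  have hu0 : ∀ r, u 0 r = 0 := by
    intro r
    have := huniq (Real.arsinh r)
    simp only [Real.sinh_arsinh] at this
    have h1 : jb r * u 0 r = 0 := by linarith
    exact (mul_eq_zero.1 h1).resolve_left (jb_pos r).ne'
  intro t r
  refine ⟨by rw [hus, hu0], ?_⟩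
  rw [et]; exact hut t r
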